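/- Let p be a prime and F a field of characteristic p. Let n be a positive integer and let C be a cyclic F-algebra with exp C = p and deg C = p^n. Then λ_p(C) ≤ p^{n−1}. -/

import Mathlib

open scoped TensorProduct

/-- A finite-dimensional central simple algebra over a field `F`. -/
def IsCSA (F A : Type) [Field F] [Ring A] [Algebra F A] : Prop :=
  Algebra.IsCentral F A ∧ IsSimpleRing A ∧ FiniteDimensional F A

/-- An `F`-algebra is split if it is isomorphic to a matrix algebra over `F`. -/
def IsSplitAlg (F A : Type) [Field F] [Ring A] [Algebra F A] : Prop :=
  ∃ n : ℕ, 0 < n ∧ Nonempty (A ≃ₐ[F] Matrix (Fin n) (Fin n) F)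

/-- Brauer equivalence of two algebras over a field `F`. -/
def IsBrauerEquiv (F A B : Type) [Field F] [Ring A] [Algebra F A] [Ring B] [Algebra F B] :
    Prop :=
  ∃ n m : ℕ, 0 < n ∧ 0 < m ∧
    Nonempty ((Matrix (Fin n) (Fin n) A) ≃ₐ[F] (Matrix (Fin m) (Fin m) B))

/-- `A` has exponent `e`: `e` is the least positive integer such that the `e`-fold tensor
power of `A` over `F` is split. -/
def HasExponent (F A : Type) [Field F] [Ring A] [Algebra F A] (e : ℕ) : Prop :=
  0 < e ∧ IsSplitAlg F (⨂[F] _ : Fin e, A) ∧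
    ∀ k : ℕ, 0 < k → IsSplitAlg F (⨂[F] _ : Fin k, A) → e ≤ k

/-- `A` has (Schur) index `d`: `A` is isomorphic to a matrix algebra over a division
algebra of dimension `d ^ 2` over `F`. -/
def HasIndex (F A : Type) [Field F] [Ring A] [Algebra F A] (d : ℕ) : Prop :=
  ∃ (D : Type) (_ : DivisionRing D) (_ : Algebra F D) (m : ℕ), 0 < m ∧
    Nonempty (A ≃ₐ[F] Matrix (Fin m) (Fin m) D) ∧ Module.finrank F D = d ^ 2

/-- The (Schur) index of `A` is at most `d`. -/
def IndexLE (F A : Type) [Field F] [Ring A] [Algebra F A] (d : ℕ) : Prop :=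
  ∃ e : ℕ, e ≤ d ∧ HasIndex F A e

/-- `A` is the cyclic (symbol) algebra `[a, b)_{p,F}` of degree `p` in characteristic `p`:
it has dimension `p ^ 2` over `F` and is generated by elements `i`, `j` subject to
`i ^ p - i = a`, `j ^ p = b`, `j * i = (i - 1) * j`. -/
def IsCyclicAlgWith (p : ℕ) (F A : Type) [Field F] [Ring A] [Algebra F A] (a b : F) : Prop :=
  b ≠ 0 ∧ Module.finrank F A = p ^ 2 ∧
    ∃ i j : A, i ^ p - i = algebraMap F A a ∧ j ^ p = algebraMap F A b ∧
      j * i = (i - 1) * j ∧ Algebra.adjoin F {i, j} = ⊤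

/-- `A` is a cyclic algebra of degree `p`, i.e. of the form `[a, b)_{p,F}`. -/
def IsCyclicPAlg (p : ℕ) (F A : Type) [Field F] [Ring A] [Algebra F A] : Prop :=
  ∃ a b : F, IsCyclicAlgWith p F A a b

/-- The `p`-symbol length of `A` is at most `m`: `A` is Brauer equivalent to a tensor
product of at most `m` cyclic `F`-algebras of degree `p`. -/
def SymbolLengthLE (p : ℕ) (F A : Type) [Field F] [Ring A] [Algebra F A] (m : ℕ) : Prop :=
  ∃ k : ℕ, k ≤ m ∧ ∃ (D : Fin k → Type) (_ : ∀ i, Ring (D i)) (_ : ∀ i, Algebra F (D i)),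
    (∀ i, IsCyclicPAlg p F (D i)) ∧ IsBrauerEquiv F A (⨂[F] i, D i)

/-- `M` is a compositum `LK` of `L` and `K` over `F`: it is generated as an `F`-algebra by
the images of `L` and `K`. -/
def IsCompositum (F L K M : Type) [Field F] [Field L] [Field K] [Field M]
    [Algebra F L] [Algebra F K] [Algebra F M] [Algebra L M] [Algebra K M]
    [IsScalarTower F L M] [IsScalarTower F K M] : Prop :=
  (IsScalarTower.toAlgHom F L M).range ⊔ (IsScalarTower.toAlgHom F K M).range = ⊤

/-- A cyclic algebra of degree `m` over `F`: a central simple `F`-algebra of degree `m`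
containing a cyclic field extension of `F` of degree `m` (as a maximal subfield). -/
def IsCyclicAlgebra (F A : Type) [Field F] [Ring A] [Algebra F A] (m : ℕ) : Prop :=
  IsCSA F A ∧ Module.finrank F A = m ^ 2 ∧
  ∃ (L : Type) (_ : Field L) (_ : Algebra F L), IsGalois F L ∧ IsCyclic (L ≃ₐ[F] L) ∧
    Module.finrank F L = m ∧ Nonempty (L →ₐ[F] A)

/-- `L/F` is a `p`-extension: there is a tower of intermediate fields from `F` to `L`
each step of which is a cyclic extension of degree `p`. -/
def IsPExtension (p : ℕ) (F L : Type) [Field F] [Field L] [Algebra F L] : Prop :=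
  ∃ (n : ℕ) (T : Fin (n + 1) → IntermediateField F L),
    T 0 = ⊥ ∧ T (Fin.last n) = ⊤ ∧
    ∀ i : Fin n, ∃ h : T i.castSucc ≤ T i.succ,
      IsGalois (T i.castSucc) (IntermediateField.extendScalars h) ∧
      IsCyclic ((IntermediateField.extendScalars h) ≃ₐ[T i.castSucc]
        (IntermediateField.extendScalars h)) ∧
      Module.finrank (T i.castSucc) (IntermediateField.extendScalars h) = p

/-- `F` is `p`-cyclic reducible: for every central simple `F`-algebra `A` of exponent `p`
and every purely inseparable extension `K/F` with `K ^ p ⊆ F`, either `A_K` is split, or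
there is a separable extension `L/F` of degree `ind (A_K) / p` such that `A_{LK}` is
Brauer equivalent to a cyclic `LK`-algebra of degree `p`. -/
def IsPCyclicReducible (p : ℕ) (F : Type) [Field F] : Prop :=
  ∀ (A : Type) [Ring A] [Algebra F A], IsCSA F A → HasExponent F A p →
  ∀ (K : Type) [Field K] [Algebra F K], IsPurelyInseparable F K →
    (∀ z : K, z ^ p ∈ (algebraMap F K).range) →
    IsSplitAlg K (K ⊗[F] A) ∨
    ∃ d : ℕ, HasIndex K (K ⊗[F] A) (p * d) ∧
      ∃ (L : Type) (_ : Field L) (_ : Algebra F L), Algebra.IsSeparable F L ∧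
        Module.finrank F L = d ∧
        ∃ (M : Type) (_ : Field M) (_ : Algebra F M) (_ : Algebra L M) (_ : Algebra K M)
          (_ : IsScalarTower F L M) (_ : IsScalarTower F K M),
          IsCompositum F L K M ∧
          ∃ (C : Type) (_ : Ring C) (_ : Algebra M C),
            IsCyclicPAlg p M C ∧ IsBrauerEquiv M (M ⊗[F] A) C

/-- `F` is `p`-reducible: for every central simple `F`-algebra `A` of exponent `p`
and every purely inseparable extension `K/F` with `K ^ p ⊆ F`, either `A_K` is split, or
there is a separable extension `L/F` of degree `ind (A_K) / p` with `ind A_{LK} = p`. -/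
def IsPReducible (p : ℕ) (F : Type) [Field F] : Prop :=
  ∀ (A : Type) [Ring A] [Algebra F A], IsCSA F A → HasExponent F A p →
  ∀ (K : Type) [Field K] [Algebra F K], IsPurelyInseparable F K →
    (∀ z : K, z ^ p ∈ (algebraMap F K).range) →
    IsSplitAlg K (K ⊗[F] A) ∨
    ∃ d : ℕ, HasIndex K (K ⊗[F] A) (p * d) ∧
      ∃ (L : Type) (_ : Field L) (_ : Algebra F L), Algebra.IsSeparable F L ∧
        Module.finrank F L = d ∧
        ∃ (M : Type) (_ : Field M) (_ : Algebra F M) (_ : Algebra L M) (_ : Algebra K M)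
          (_ : IsScalarTower F L M) (_ : IsScalarTower F K M),
          IsCompositum F L K M ∧ HasIndex M (M ⊗[F] A) p

/-- Separation step of the density theorem: an irreducible algebra of operators with scalar
commutant contains an operator killing a given finite set but not a given vector outside its
span. -/
theorem exists_mem_eq_zero_ne_zero {F V : Type*} [Field F] [AddCommGroup V] [Module F V]
    (S : Subalgebra F (Module.End F V))
    (hirr : ∀ U : Submodule F V, (∀ s ∈ S, ∀ v ∈ U, s v ∈ U) → U = ⊥ ∨ U = ⊤)
    (hcomm : ∀ f : Module.End F V, (∀ s ∈ S, f * s = s * f) → ∃ c : F, ∀ v, f v = c • v)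
    (t : Finset V) (v : V) (hv : v ∉ Submodule.span F (t : Set V)) :
    ∃ s ∈ S, (∀ w ∈ t, s w = 0) ∧ s v ≠ 0 := by
  classical
  induction t using Finset.induction_on generalizing v with
  | empty =>
    refine ⟨1, S.one_mem, by simp, ?_⟩
    intro h
    apply hv
    simpa using h
  | insert w t hwt ih =>
    by_cases hw : w ∈ Submodule.span F (t : Set V)
    · obtain ⟨s, hs, hst, hsv⟩ := ih v (by
        intro h
        exact hv (Submodule.span_mono (by simp) h))
      refine ⟨s, hs, ?_, hsv⟩
      have : Submodule.span F (t : Set V) ≤ LinearMap.ker s :=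
        Submodule.span_le.2 fun x hx => hst x hx
      intro x hx
      rcases Finset.mem_insert.1 hx with rfl | hx
      · exact this hw
      · exact hst x hx
    · by_contra! hcon
      let I : Submodule F (Module.End F V) :=
        { carrier := {s | s ∈ S ∧ ∀ x ∈ t, s x = 0}
          add_mem' := fun {a b} ha hb => ⟨S.add_mem ha.1 hb.1, fun x hx => by
            simp [ha.2 x hx, hb.2 x hx]⟩
          zero_mem' := ⟨S.zero_mem, by simp⟩
          smul_mem' := fun c a ha => ⟨S.smul_mem ha.1 c, fun x hx => by simp [ha.2 x hx]⟩ }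
      let ev : V → (I →ₗ[F] V) := fun x => (LinearMap.applyₗ x).comp I.subtype
      have hev : ∀ x (s : I), ev x s = s.1 x := fun _ _ => rfl
      have hsurj : LinearMap.range (ev w) = ⊤ := by
        refine (hirr _ ?_).resolve_left ?_
        · rintro a ha _ ⟨s, rfl⟩
          exact ⟨⟨a * s.1, S.mul_mem ha s.2.1, fun x hx => by simp [s.2.2 x hx]⟩, rfl⟩
        · intro hbot
          obtain ⟨s, hs, hst, hsw⟩ := ih w hw
          have : ev w ⟨s, hs, hst⟩ ∈ LinearMap.range (ev w) := ⟨_, rfl⟩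
          rw [hbot] at this
          exact hsw ((Submodule.mem_bot F).1 this)
      have hker : LinearMap.ker (ev w) ≤ LinearMap.ker (ev v) := by
        intro s hs
        refine hcon s.1 s.2.1 ?_
        intro x hx
        rcases Finset.mem_insert.1 hx with rfl | hx
        · exact hs
        · exact s.2.2 x hx
      obtain ⟨g, hg⟩ := (ev w).exists_rightInverse_of_surjective hsurj
      have hg' : ∀ x, (g x).1 w = x := fun x => LinearMap.congr_fun hg x
      have key : ∀ s : I, (g (s.1 w)).1 v = s.1 v := by
        intro s
        have : g (s.1 w) - s ∈ LinearMap.ker (ev v) := hker (by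
          simp [hev, hg'])
        simpa [hev, sub_eq_zero] using this
      obtain ⟨c, hc⟩ := hcomm ((ev v).comp g) (by
        intro a ha
        ext x
        have h1 := key ⟨a * (g x).1, S.mul_mem ha (g x).2.1, fun y hy => by
          simp [(g x).2.2 y hy]⟩
        simpa [hev, hg'] using h1)
      obtain ⟨s, hs, hst, hsv⟩ := ih (v - c • w) (by
        intro h
        apply hv
        have := Submodule.add_mem _ (Submodule.span_mono (by simp) h)
          (Submodule.smul_mem _ c (Submodule.subset_span
            (show w ∈ ((insert w t : Finset V) : Set V) by simp)))
        simpa using this)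
      apply hsv
      have h1 := key ⟨s, hs, hst⟩
      have h2 := hc (s w)
      simp only [LinearMap.comp_apply, hev] at h2
      simp only at h1
      rw [map_sub, map_smul, ← h1, h2, sub_self]

/-- Burnside's theorem: an irreducible algebra of operators on a finite-dimensional space whose
commutant is scalar contains every operator. -/
theorem Subalgebra.eq_top_of_irreducible {F V : Type*} [Field F] [AddCommGroup V] [Module F V]
    [FiniteDimensional F V] (S : Subalgebra F (Module.End F V))
    (hirr : ∀ U : Submodule F V, (∀ s ∈ S, ∀ v ∈ U, s v ∈ U) → U = ⊥ ∨ U = ⊤)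
    (hcomm : ∀ f : Module.End F V, (∀ s ∈ S, f * s = s * f) → ∃ c : F, ∀ v, f v = c • v) :
    S = ⊤ := by
  classical
  rw [eq_top_iff]
  rintro f -
  let b := Module.finBasis F V
  have hproj : ∀ i x, ∃ s ∈ S, ∀ j, s (b j) = if j = i then x else 0 := by
    intro i x
    have hli : b i ∉ Submodule.span F ((Finset.univ.erase i).image b : Set V) := by
      have := b.linearIndependent.notMem_span_image (s := {j | j ≠ i}) (x := i) (by simp)
      convert this using 4
      ext
      simp
    obtain ⟨s, hs, hst, hsi⟩ := exists_mem_eq_zero_ne_zero S hirr hcomm _ _ hli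
    let ev : S →ₗ[F] V := (LinearMap.applyₗ (s (b i))).comp S.val.toLinearMap
    have htop : LinearMap.range ev = ⊤ := by
      refine (hirr _ ?_).resolve_left ?_
      · rintro a ha _ ⟨r, rfl⟩
        exact ⟨⟨a, ha⟩ * r, rfl⟩
      · intro hbot
        have : ev 1 ∈ LinearMap.range ev := ⟨_, rfl⟩
        rw [hbot] at this
        exact hsi ((Submodule.mem_bot F).1 this)
    obtain ⟨r, hr⟩ : x ∈ LinearMap.range ev := htop ▸ Submodule.mem_top
    refine ⟨r.1 * s, S.mul_mem r.2 hs, fun j => ?_⟩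
    split_ifs with h
    · subst h; exact hr
    · simp [hst (b j) (Finset.mem_image_of_mem _ (by simp [h]))]
  choose s hs hsb using fun i => hproj i (f (b i))
  have : f = ∑ i, s i := b.ext fun j => by simp [hsb]
  rw [this]
  exact S.sum_mem fun i _ => hs i

/-- A finite-dimensional central simple algebra is Azumaya. -/
theorem mulLeftRight_bijective {F A : Type*} [Field F] [Ring A] [Algebra F A]
    [Algebra.IsCentral F A] [IsSimpleRing A] [FiniteDimensional F A] :
    Function.Bijective (AlgHom.mulLeftRight F A) := by
  have hsurj : Function.Surjective (AlgHom.mulLeftRight F A) := by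
    rw [← AlgHom.range_eq_top]
    have hmem : ∀ a b : A, LinearMap.mulLeft F a * LinearMap.mulRight F b ∈
        (AlgHom.mulLeftRight F A).range := fun a b =>
      ⟨a ⊗ₜ MulOpposite.op b, by ext x; simp [mul_assoc]⟩
    apply Subalgebra.eq_top_of_irreducible
    · intro U hU
      let J : TwoSidedIdeal A := TwoSidedIdeal.mk' (U : Set A) U.zero_mem
        (fun hx hy => U.add_mem hx hy) (fun hx => U.neg_mem hx)
        (fun {x y} hy => by simpa using hU _ (hmem x 1) y hy)
        (fun {x y} hx => by simpa using hU _ (hmem 1 y) x hx)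
      have hJ : ∀ x, x ∈ J ↔ x ∈ U := fun x => by simp [J, TwoSidedIdeal.mem_mk']
      rcases eq_bot_or_eq_top J with h | h
      · left
        ext x
        rw [← hJ, h]
        simp
      · right
        ext x
        rw [← hJ, h]
        simp
    · intro f hf
      have h1 : ∀ a b x : A, f (a * (x * b)) = a * (f x * b) := fun a b x => by
        simpa using LinearMap.congr_fun (hf _ (hmem a b)) x
      have hc : f 1 ∈ Subalgebra.center F A := by
        rw [Subalgebra.mem_center_iff]
        intro a
        have e1 := h1 a 1 1
        have e2 := h1 1 a 1
        simp only [one_mul, mul_one] at e1 e2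
        rw [← e1, ← e2]
      rw [Algebra.IsCentral.center_eq_bot] at hc
      obtain ⟨c, hc⟩ := Algebra.mem_bot.1 hc
      refine ⟨c, fun v => ?_⟩
      have e1 := h1 v 1 1
      simp only [mul_one] at e1
      rw [e1, ← hc, Algebra.smul_def, Algebra.commutes]
  refine ⟨?_, hsurj⟩
  have hd : Module.finrank F (A ⊗[F] Aᵐᵒᵖ) = Module.finrank F (Module.End F A) := by
    rw [Module.finrank_tensorProduct, Module.finrank_linearMap,
      (MulOpposite.opLinearEquiv F (M := A)).finrank_eq]
  exact (LinearMap.injective_iff_surjective_of_finrank_eq_finrank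
    (f := (AlgHom.mulLeftRight F A).toLinearMap) hd).2 hsurj

/-- The map `x ⊗ y ↦ (τ ↦ x * τ y)` from `L ⊗ L` to the functions on the Galois group. -/
noncomputable def galoisTensorPi (F L : Type*) [Field F] [Field L] [Algebra F L] :
    L ⊗[F] L →ₐ[L] (Gal(L/F) → L) :=
  Algebra.TensorProduct.lift (Algebra.ofId L _)
    (AlgHom.pi fun τ : Gal(L/F) => (τ : L →ₐ[F] L)) fun _ _ => Commute.all _ _

theorem galoisTensorPi_tmul {F L : Type*} [Field F] [Field L] [Algebra F L] (x y : L)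
    (τ : Gal(L/F)) : galoisTensorPi F L (x ⊗ₜ y) τ = x * τ y := by
  simp [galoisTensorPi, Algebra.ofId_apply]

theorem galoisTensorPi_bijective {F L : Type*} [Field F] [Field L] [Algebra F L]
    [FiniteDimensional F L] [IsGalois F L] : Function.Bijective (galoisTensorPi F L) := by
  classical
  have hsurj : Function.Surjective (galoisTensorPi F L) := by
    change Function.Surjective (galoisTensorPi F L).toLinearMap
    rw [← LinearMap.range_eq_top]
    by_contra hne
    obtain ⟨φ, hφ, hle⟩ := Submodule.exists_le_ker_of_lt_top _ (lt_top_iff_ne_top.2 hne)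
    apply hφ
    have hexp : ∀ f : Gal(L/F) → L, φ f = ∑ τ, f τ * φ (Pi.single τ 1) := by
      intro f
      conv_lhs => rw [← Finset.univ_sum_single f]
      rw [map_sum]
      refine Finset.sum_congr rfl fun τ _ => ?_
      rw [← smul_eq_mul, ← map_smul, ← Pi.single_smul, smul_eq_mul, mul_one]
    have hli : LinearIndependent L (fun τ : Gal(L/F) => (τ : L → L)) := by
      have h := (linearIndependent_monoidHom L L).comp
        (fun τ : Gal(L/F) => ((τ : L →+* L) : L →* L)) (by
          intro a b hab
          ext x
          exact DFunLike.congr_fun hab x)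
      exact h
    rw [Fintype.linearIndependent_iff] at hli
    have hz := hli (fun τ => φ (Pi.single τ 1)) (by
      ext y
      have h1 : φ (galoisTensorPi F L (1 ⊗ₜ y)) = 0 := hle ⟨1 ⊗ₜ y, rfl⟩
      rw [hexp] at h1
      simpa [galoisTensorPi_tmul, mul_comm] using h1)
    ext f
    simp only [LinearMap.comp_apply, LinearMap.coe_single, LinearMap.zero_apply]
    exact hz _
  refine ⟨?_, hsurj⟩
  have hd : Module.finrank L (L ⊗[F] L) = Module.finrank L (Gal(L/F) → L) := by
    rw [Module.finrank_baseChange, Module.finrank_fintype_fun_eq_card, ← Nat.card_eq_fintype_card,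
      IsGalois.card_aut_eq_finrank]
  exact (LinearMap.injective_iff_surjective_of_finrank_eq_finrank
    (f := (galoisTensorPi F L).toLinearMap) hd).2 hsurj

/-- On a vector where the second copy of `L` acts through `τ` and the first copy, an element of
`L ⊗ L` acts through its value at `τ`. -/
theorem galoisTensor_apply_of_twisted {F L V : Type*} [Field F] [Field L] [Algebra F L]
    [AddCommGroup V] [Module F V]
    (Ψ : L ⊗[F] L →ₐ[F] Module.End F V) (τ : Gal(L/F)) (v : V)
    (hv : ∀ y, Ψ (1 ⊗ₜ y) v = Ψ (τ y ⊗ₜ 1) v) (t : L ⊗[F] L) :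
    Ψ t v = Ψ (galoisTensorPi F L t τ ⊗ₜ 1) v := by
  induction t with
  | zero => simp
  | add a b ha hb => simp [ha, hb, TensorProduct.add_tmul]
  | tmul x y =>
    rw [galoisTensorPi_tmul]
    have h1 : x ⊗ₜ[F] y = (x ⊗ₜ 1) * (1 ⊗ₜ y) := by simp
    have h2 : (x * τ y) ⊗ₜ[F] (1 : L) = (x ⊗ₜ 1) * (τ y ⊗ₜ 1) := by simp
    rw [h1, h2, map_mul, map_mul, Module.End.mul_apply, Module.End.mul_apply, hv]

/-- The idempotent of `L ⊗ L` on which `1 ⊗ y` acts as `τ y ⊗ 1`. -/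
noncomputable def galoisIdem {F L : Type*} [Field F] [Field L] [Algebra F L]
    [FiniteDimensional F L] [IsGalois F L] (τ : Gal(L/F)) : L ⊗[F] L :=
  open scoped Classical in
  (galoisTensorPi_bijective (F := F) (L := L)).2 (Pi.single τ 1) |>.choose

section

variable {F L : Type*} [Field F] [Field L] [Algebra F L] [FiniteDimensional F L] [IsGalois F L]

open scoped Classical in
theorem galoisTensorPi_galoisIdem (τ : Gal(L/F)) :
    galoisTensorPi F L (galoisIdem τ) = Pi.single τ 1 :=
  ((galoisTensorPi_bijective (F := F) (L := L)).2 (Pi.single τ 1)).choose_spec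

theorem galoisIdem_ne_zero (τ : Gal(L/F)) : galoisIdem τ ≠ 0 := by
  classical
  intro h
  have := galoisTensorPi_galoisIdem τ
  rw [h, map_zero] at this
  simpa using congrFun this τ

theorem sum_galoisIdem : ∑ τ : Gal(L/F), galoisIdem τ = 1 := by
  classical
  apply (galoisTensorPi_bijective (F := F) (L := L)).1
  rw [map_sum, map_one]
  simp_rw [galoisTensorPi_galoisIdem]
  exact Finset.univ_sum_single (1 : Gal(L/F) → L)

theorem one_tmul_mul_galoisIdem (τ : Gal(L/F)) (y : L) :
    (1 ⊗ₜ y) * galoisIdem τ = (τ y ⊗ₜ[F] (1 : L)) * galoisIdem τ := by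
  classical
  apply (galoisTensorPi_bijective (F := F) (L := L)).1
  ext τ'
  simp only [map_mul, Pi.mul_apply, galoisTensorPi_tmul, galoisTensorPi_galoisIdem]
  by_cases h : τ' = τ
  · subst h; simp
  · simp [h]

theorem galoisIdem_apply_self {V : Type*} [AddCommGroup V] [Module F V]
    (Ψ : L ⊗[F] L →ₐ[F] Module.End F V) (τ : Gal(L/F)) (v : V)
    (hv : ∀ y, Ψ (1 ⊗ₜ y) v = Ψ (τ y ⊗ₜ 1) v) : Ψ (galoisIdem τ) v = v := by
  classical
  rw [galoisTensor_apply_of_twisted Ψ τ v hv, galoisTensorPi_galoisIdem, Pi.single_eq_same,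
    ← Algebra.TensorProduct.one_def, map_one, Module.End.one_apply]

theorem galoisIdem_apply_of_ne {V : Type*} [AddCommGroup V] [Module F V]
    (Ψ : L ⊗[F] L →ₐ[F] Module.End F V) {τ τ' : Gal(L/F)} (h : τ ≠ τ') (v : V)
    (hv : ∀ y, Ψ (1 ⊗ₜ y) v = Ψ (τ y ⊗ₜ 1) v) : Ψ (galoisIdem τ') v = 0 := by
  classical
  rw [galoisTensor_apply_of_twisted Ψ τ v hv, galoisTensorPi_galoisIdem, Pi.single_eq_of_ne h,
    TensorProduct.zero_tmul, map_zero, LinearMap.zero_apply]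

theorem galoisIdem_apply_twisted {V : Type*} [AddCommGroup V] [Module F V]
    (Ψ : L ⊗[F] L →ₐ[F] Module.End F V) (τ : Gal(L/F)) (v : V) (y : L) :
    Ψ (1 ⊗ₜ y) (Ψ (galoisIdem τ) v) = Ψ (τ y ⊗ₜ 1) (Ψ (galoisIdem τ) v) := by
  rw [← Module.End.mul_apply, ← map_mul, one_tmul_mul_galoisIdem, map_mul, Module.End.mul_apply]

theorem sum_galoisIdem_apply {V : Type*} [AddCommGroup V] [Module F V]
    (Ψ : L ⊗[F] L →ₐ[F] Module.End F V) (v : V) :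
    ∑ τ : Gal(L/F), Ψ (galoisIdem τ) v = v := by
  rw [← LinearMap.sum_apply, ← map_sum, sum_galoisIdem, map_one, Module.End.one_apply]

end

section

variable {F L V : Type*} [Field F] [Field L] [Algebra F L] [AddCommGroup V] [Module F V]

/-- The subspace of `V` on which the two actions of `L` agree. -/
def coincidence (ρ₀ ρ₁ : L →ₐ[F] Module.End F V) : Submodule F V where
  carrier := {v | ∀ y, ρ₁ y v = ρ₀ y v}
  add_mem' := fun {a b} ha hb y => by simp [ha y, hb y]
  zero_mem' := fun y => by simp
  smul_mem' := fun c a ha y => by simp [ha y]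

theorem mem_coincidence {ρ₀ ρ₁ : L →ₐ[F] Module.End F V} {v : V} :
    v ∈ coincidence ρ₀ ρ₁ ↔ ∀ y, ρ₁ y v = ρ₀ y v := Iff.rfl

/-- If `U` is stable under two commuting actions of `L` and under operators implementing the
Galois group on the second one, then the part of `U` where the actions agree has codegree
`[L : F]`. -/
theorem finrank_coincidence_inf [FiniteDimensional F L] [IsGalois F L] [FiniteDimensional F V]
    (ρ₀ ρ₁ : L →ₐ[F] Module.End F V) (hcomm : ∀ x y, Commute (ρ₀ x) (ρ₁ y))
    (g h : Gal(L/F) → Module.End F V) (hgh : ∀ τ, g τ * h τ = 1) (hhg : ∀ τ, h τ * g τ = 1)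
    (hg : ∀ τ y, g τ * ρ₁ y = ρ₁ (τ y) * g τ) (hg₀ : ∀ τ y, Commute (ρ₀ y) (g τ))
    (U : Submodule F V) (hU₀ : ∀ y, ∀ v ∈ U, ρ₀ y v ∈ U) (hU₁ : ∀ y, ∀ v ∈ U, ρ₁ y v ∈ U)
    (hUg : ∀ τ, ∀ v ∈ U, g τ v ∈ U) (hUh : ∀ τ, ∀ v ∈ U, h τ v ∈ U) :
    Module.finrank F ↥(coincidence ρ₀ ρ₁ ⊓ U) * Module.finrank F L = Module.finrank F U := by
  classical
  let Ψ : L ⊗[F] L →ₐ[F] Module.End F V := Algebra.TensorProduct.lift ρ₀ ρ₁ hcomm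
  have hΨ₀ : ∀ y, Ψ (y ⊗ₜ 1) = ρ₀ y := fun y => by simp [Ψ]
  have hΨ₁ : ∀ y, Ψ (1 ⊗ₜ y) = ρ₁ y := fun y => by simp [Ψ]
  have hΨU : ∀ t, ∀ v ∈ U, Ψ t v ∈ U := by
    intro t v hv
    induction t with
    | zero => simp
    | add a b ha hb => simpa using U.add_mem ha hb
    | tmul x y => simpa [Ψ] using hU₀ x _ (hU₁ y v hv)
  have hh : ∀ τ y v, ρ₁ y (h τ v) = h τ (ρ₁ (τ y) v) := fun τ y v => by
    have : ρ₁ y * h τ = h τ * ρ₁ (τ y) := by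
      calc ρ₁ y * h τ = (h τ * g τ) * (ρ₁ y * h τ) := by rw [hhg, one_mul]
        _ = h τ * (g τ * ρ₁ y) * h τ := by simp only [mul_assoc]
        _ = h τ * ρ₁ (τ y) * (g τ * h τ) := by rw [hg]; simp only [mul_assoc]
        _ = _ := by rw [hgh, mul_one]
    exact LinearMap.congr_fun this v
  have hh₀ : ∀ τ y v, ρ₀ y (h τ v) = h τ (ρ₀ y v) := fun τ y v => by
    have : ρ₀ y * h τ = h τ * ρ₀ y := by
      calc ρ₀ y * h τ = (h τ * g τ) * (ρ₀ y * h τ) := by rw [hhg, one_mul]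
        _ = h τ * (g τ * ρ₀ y) * h τ := by simp only [mul_assoc]
        _ = h τ * ρ₀ y * (g τ * h τ) := by rw [← (hg₀ τ y).eq]; simp only [mul_assoc]
        _ = _ := by rw [hgh, mul_one]
    exact LinearMap.congr_fun this v
  have hg' : ∀ τ y v, g τ (ρ₁ y v) = ρ₁ (τ y) (g τ v) := fun τ y v =>
    LinearMap.congr_fun (hg τ y) v
  have hg₀' : ∀ τ y v, ρ₀ y (g τ v) = g τ (ρ₀ y v) := fun τ y v =>
    LinearMap.congr_fun (hg₀ τ y).eq v
  have hmem : ∀ τ, ∀ v ∈ U, g τ (Ψ (galoisIdem τ) v) ∈ coincidence ρ₀ ρ₁ ⊓ U := by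
    intro τ v hv
    refine ⟨fun y => ?_, hUg τ _ (hΨU _ _ hv)⟩
    have h1 := galoisIdem_apply_twisted Ψ τ v (τ.symm y)
    rw [hΨ₁, hΨ₀, AlgEquiv.apply_symm_apply] at h1
    have h2 := hg' τ (τ.symm y) (Ψ (galoisIdem τ) v)
    rw [AlgEquiv.apply_symm_apply] at h2
    rw [← h2, h1, hg₀']
  let φ : U →ₗ[F] (Gal(L/F) → ↥(coincidence ρ₀ ρ₁ ⊓ U)) := LinearMap.pi fun τ =>
    LinearMap.codRestrict _ ((g τ * Ψ (galoisIdem τ)).comp U.subtype)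
      fun v => hmem τ v.1 v.2
  let ψ : (Gal(L/F) → ↥(coincidence ρ₀ ρ₁ ⊓ U)) →ₗ[F] U :=
    ∑ τ, LinearMap.codRestrict U (((h τ).comp (Submodule.subtype _)).comp (LinearMap.proj τ))
      fun w => hUh τ _ (w τ).2.2
  have hφ : ∀ v τ, ((φ v τ : ↥(coincidence ρ₀ ρ₁ ⊓ U)) : V) = g τ (Ψ (galoisIdem τ) v) :=
    fun _ _ => rfl
  have hψ : ∀ w, ((ψ w : U) : V) = ∑ τ, h τ (w τ : V) := by
    intro w
    simp [ψ, LinearMap.sum_apply]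
  have e : U ≃ₗ[F] (Gal(L/F) → ↥(coincidence ρ₀ ρ₁ ⊓ U)) := by
    refine LinearEquiv.ofLinearMap φ ψ ?_ ?_
    · refine LinearMap.ext fun w => funext fun τ => Subtype.ext ?_
      change ((φ (ψ w) τ : ↥(coincidence ρ₀ ρ₁ ⊓ U)) : V) = (w τ : V)
      rw [hφ, hψ, map_sum]
      have htw : ∀ τ' y, Ψ (1 ⊗ₜ y) (h τ' (w τ' : V)) = Ψ (τ' y ⊗ₜ 1) (h τ' (w τ' : V)) := by
        intro τ' y
        rw [hΨ₁, hΨ₀, hh, hh₀, (w τ').2.1]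
      rw [Finset.sum_eq_single τ]
      · rw [galoisIdem_apply_self Ψ τ _ (htw τ), ← Module.End.mul_apply, hgh, Module.End.one_apply]
      · intro τ' _ hne
        exact galoisIdem_apply_of_ne Ψ hne _ (htw τ')
      · simp
    · refine LinearMap.ext fun v => Subtype.ext ?_
      change ((ψ (φ v) : U) : V) = (v : V)
      rw [hψ]
      simp_rw [hφ, ← Module.End.mul_apply, ← mul_assoc, hhg, one_mul]
      exact sum_galoisIdem_apply Ψ v.1
  rw [e.finrank_eq, Module.finrank_pi_fintype, Finset.sum_const, smul_eq_mul, Finset.card_univ,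
    ← Nat.card_eq_fintype_card, IsGalois.card_aut_eq_finrank, mul_comm]

/-- Iterated form of `finrank_coincidence_inf` for a family of commuting actions. -/
theorem finrank_iInf_coincidence [FiniteDimensional F L] [IsGalois F L] [FiniteDimensional F V]
    {ι : Type*} (ρ : ι → L →ₐ[F] Module.End F V) (g h : ι → Gal(L/F) → Module.End F V)
    (hρ : ∀ i j, i ≠ j → ∀ x y, Commute (ρ i x) (ρ j y))
    (hρg : ∀ i j, i ≠ j → ∀ x τ, Commute (ρ i x) (g j τ))
    (hρh : ∀ i j, i ≠ j → ∀ x τ, Commute (ρ i x) (h j τ))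
    (hgh : ∀ i τ, g i τ * h i τ = 1) (hhg : ∀ i τ, h i τ * g i τ = 1)
    (hg : ∀ i τ y, g i τ * ρ i y = ρ i (τ y) * g i τ) (i₀ : ι) (s : Finset ι) (hs : i₀ ∉ s) :
    Module.finrank F ↥(⨅ i ∈ s, coincidence (ρ i₀) (ρ i)) * Module.finrank F L ^ s.card =
      Module.finrank F V := by
  classical
  induction s using Finset.induction_on with
  | empty =>
    have htop : (⨅ i ∈ (∅ : Finset ι), coincidence (ρ i₀) (ρ i)) = ⊤ := by simp
    rw [htop, finrank_top, Finset.card_empty, pow_zero, mul_one]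
  | insert i s his ih =>
    rw [Finset.mem_insert, not_or] at hs
    rw [Finset.iInf_insert, Finset.card_insert_of_notMem his, ← ih hs.2, pow_succ']
    rw [← mul_assoc]
    congr 1
    have hstab : ∀ f : Module.End F V, (∀ j ∈ s, ∀ y, Commute (ρ j y) f) →
        (∀ y, Commute (ρ i₀ y) f) →
        ∀ v ∈ ⨅ j ∈ s, coincidence (ρ i₀) (ρ j), f v ∈ ⨅ j ∈ s, coincidence (ρ i₀) (ρ j) := by
      intro f hf hf₀ v hv
      simp only [Submodule.mem_iInf, mem_coincidence] at hv ⊢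
      intro j hj y
      have h1 := LinearMap.congr_fun (hf j hj y).eq v
      have h2 := LinearMap.congr_fun (hf₀ y).eq v
      simp only [Module.End.mul_apply] at h1 h2
      rw [h1, h2, hv j hj]
    have hji : ∀ j ∈ s, j ≠ i := fun j hj hji => his (hji ▸ hj)
    have hρ₀ : ∀ j ∈ s, j ≠ i₀ := fun j hj hji => hs.2 (hji ▸ hj)
    refine finrank_coincidence_inf (ρ i₀) (ρ i) (hρ _ _ hs.1) (g i) (h i) (hgh i) (hhg i) (hg i)
      (fun τ y => hρg _ _ hs.1 y τ) _ (fun y => hstab _ (fun j hj x => hρ _ _ (hρ₀ j hj) x y)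
        fun x => ?_) (fun y => hstab _ (fun j hj x => hρ _ _ (hji j hj) x y)
        fun x => hρ _ _ hs.1 x y)
      (fun τ => hstab _ (fun j hj x => hρg _ _ (hji j hj) x τ) fun x => hρg _ _ hs.1 x τ)
      (fun τ => hstab _ (fun j hj x => hρh _ _ (hji j hj) x τ) fun x => hρh _ _ hs.1 x τ)
    rw [commute_iff_eq, ← map_mul, ← map_mul, mul_comm]

end

section

variable {F L C : Type*} [Field F] [Field L] [Algebra F L] [Ring C] [Algebra F C]

/-- The action of `L ⊗ L` on an algebra containing `L` by left and right multiplication. -/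
noncomputable def bimoduleAction (j : L →ₐ[F] C) : L ⊗[F] L →ₐ[F] Module.End F C :=
  (AlgHom.mulLeftRight F C).comp
    (Algebra.TensorProduct.map j (j.toOpposite fun x y => (Commute.all x y).map j))

theorem bimoduleAction_tmul (j : L →ₐ[F] C) (x y : L) (v : C) :
    bimoduleAction j (x ⊗ₜ y) v = j x * v * j y := by
  simp [bimoduleAction]

theorem bimoduleAction_injective [Algebra.IsCentral F C] [IsSimpleRing C] [FiniteDimensional F C]
    (j : L →ₐ[F] C) : Function.Injective (bimoduleAction j) := by
  have hj : Function.Injective j := j.toRingHom.injective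
  rw [bimoduleAction, AlgHom.coe_comp]
  refine mulLeftRight_bijective.1.comp ?_
  exact TensorProduct.map_injective_of_flat_flat' j.toLinearMap
    (j.toOpposite fun x y => (Commute.all x y).map j).toLinearMap hj
    (MulOpposite.op_injective.comp hj)

/-- The elements `v` of `C` satisfying `v * y = τ y * v` for all `y ∈ L`. -/
def twistedCentralizer (j : L →ₐ[F] C) (τ : Gal(L/F)) : Submodule F C where
  carrier := {v | ∀ y, v * j y = j (τ y) * v}
  add_mem' := fun {a b} ha hb y => by rw [add_mul, mul_add, ha y, hb y]
  zero_mem' := fun y => by simp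
  smul_mem' := fun c a ha y => by rw [smul_mul_assoc, mul_smul_comm, ha y]

theorem mem_twistedCentralizer {j : L →ₐ[F] C} {τ : Gal(L/F)} {v : C} :
    v ∈ twistedCentralizer j τ ↔ ∀ y, v * j y = j (τ y) * v := Iff.rfl

theorem mem_twistedCentralizer_iff_bimoduleAction {j : L →ₐ[F] C} {τ : Gal(L/F)} {v : C} :
    v ∈ twistedCentralizer j τ ↔
      ∀ y, bimoduleAction j (1 ⊗ₜ y) v = bimoduleAction j (τ y ⊗ₜ 1) v := by
  simp [mem_twistedCentralizer, bimoduleAction_tmul]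

theorem mul_mem_twistedCentralizer {j : L →ₐ[F] C} {τ τ' : Gal(L/F)} {v w : C}
    (hv : v ∈ twistedCentralizer j τ) (hw : w ∈ twistedCentralizer j τ') :
    v * w ∈ twistedCentralizer j (τ * τ') := fun y => by
  rw [mul_assoc, hw y, ← mul_assoc, hv, mul_assoc, AlgEquiv.mul_apply]

variable [FiniteDimensional F L] [IsGalois F L]

theorem galoisIdem_mem_twistedCentralizer (j : L →ₐ[F] C) (τ : Gal(L/F)) (v : C) :
    bimoduleAction j (galoisIdem τ) v ∈ twistedCentralizer j τ :=
  mem_twistedCentralizer_iff_bimoduleAction.2 fun y =>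
    galoisIdem_apply_twisted (bimoduleAction j) τ v y

theorem sum_finrank_twistedCentralizer [FiniteDimensional F C] (j : L →ₐ[F] C) :
    ∑ τ, Module.finrank F (twistedCentralizer j τ) = Module.finrank F C := by
  classical
  let φ : C →ₗ[F] (∀ τ, twistedCentralizer j τ) := LinearMap.pi fun τ =>
    LinearMap.codRestrict _ (bimoduleAction j (galoisIdem τ))
      (galoisIdem_mem_twistedCentralizer j τ)
  let ψ : (∀ τ, twistedCentralizer j τ) →ₗ[F] C :=
    ∑ τ, (Submodule.subtype _).comp (LinearMap.proj τ)
  have hψ : ∀ w, ψ w = ∑ τ, (w τ : C) := fun w => by simp [ψ, LinearMap.sum_apply]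
  have e : C ≃ₗ[F] (∀ τ, twistedCentralizer j τ) := by
    refine LinearEquiv.ofLinearMap φ ψ ?_ ?_
    · refine LinearMap.ext fun w => funext fun τ => Subtype.ext ?_
      change bimoduleAction j (galoisIdem τ) (ψ w) = (w τ : C)
      rw [hψ, map_sum, Finset.sum_eq_single τ]
      · exact galoisIdem_apply_self _ τ _ (mem_twistedCentralizer_iff_bimoduleAction.1 (w τ).2)
      · intro τ' _ hne
        exact galoisIdem_apply_of_ne _ hne _
          (mem_twistedCentralizer_iff_bimoduleAction.1 (w τ').2)
      · simp
    · refine LinearMap.ext fun v => ?_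
      change ψ (φ v) = v
      rw [hψ]
      exact sum_galoisIdem_apply (bimoduleAction j) v
  rw [e.finrank_eq, Module.finrank_pi_fintype]

variable [Algebra.IsCentral F C] [IsSimpleRing C] [FiniteDimensional F C]

theorem exists_ne_zero_mem_twistedCentralizer (j : L →ₐ[F] C) (τ : Gal(L/F)) :
    ∃ w ∈ twistedCentralizer j τ, w ≠ 0 := by
  have h1 : bimoduleAction j (galoisIdem τ) ≠ 0 := fun h =>
    galoisIdem_ne_zero τ (bimoduleAction_injective j (by rw [h, map_zero]))
  obtain ⟨v, hv⟩ : ∃ v, bimoduleAction j (galoisIdem τ) v ≠ 0 := by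
    by_contra! h
    exact h1 (LinearMap.ext h)
  exact ⟨_, galoisIdem_mem_twistedCentralizer j τ v, hv⟩

/-- A subfield of degree `deg C` is its own centralizer. -/
theorem mem_range_of_forall_commute (j : L →ₐ[F] C)
    (hC : Module.finrank F C = Module.finrank F L ^ 2) {v : C}
    (hv : ∀ y, v * j y = j y * v) : v ∈ j.range := by
  classical
  have hj : Function.Injective j := j.toRingHom.injective
  have hge : ∀ τ, Module.finrank F L ≤ Module.finrank F (twistedCentralizer j τ) := by
    intro τ
    obtain ⟨w, hw, hw0⟩ := exists_ne_zero_mem_twistedCentralizer j τ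
    let f : L →ₗ[F] twistedCentralizer j τ :=
      LinearMap.codRestrict _ ((LinearMap.mulRight F w).comp j.toLinearMap) fun x y => by
        change j x * w * j y = j (τ y) * (j x * w)
        rw [mul_assoc, hw y, ← mul_assoc, ← mul_assoc, ← map_mul, ← map_mul, mul_comm]
    refine LinearMap.finrank_le_finrank_of_injective (f := f) ?_
    rw [injective_iff_map_eq_zero]
    intro x hx
    by_contra hx0
    have h1 : j x * w = 0 := congrArg Subtype.val hx
    apply hw0
    calc w = j x⁻¹ * (j x * w) := by rw [← mul_assoc, ← map_mul, inv_mul_cancel₀ hx0, map_one,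
        one_mul]
      _ = 0 := by rw [h1, mul_zero]
  have hsum := sum_finrank_twistedCentralizer j
  have hone : Module.finrank F (twistedCentralizer j 1) = Module.finrank F L := by
    have hcard : ∑ _τ : Gal(L/F), Module.finrank F L = Module.finrank F L ^ 2 := by
      rw [Finset.sum_const, Finset.card_univ, ← Nat.card_eq_fintype_card,
        IsGalois.card_aut_eq_finrank, smul_eq_mul, sq]
    have := (Finset.sum_eq_sum_iff_of_le fun τ _ => hge τ).1 (by rw [hcard, hsum, hC])
    exact (this 1 (Finset.mem_univ _)).symm
  have hle : LinearMap.range j.toLinearMap ≤ twistedCentralizer j 1 := by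
    rintro _ ⟨x, rfl⟩ y
    simp [← map_mul, mul_comm]
  have heq := Submodule.eq_of_le_of_finrank_eq hle (by
    rw [hone, LinearMap.finrank_range_of_inj hj])
  have : v ∈ twistedCentralizer j 1 := fun y => by simpa using hv y
  rw [← heq] at this
  obtain ⟨x, hx⟩ := this
  exact ⟨x, hx⟩

/-- Every automorphism of a maximal Galois subfield of a central simple algebra is induced by an
inner automorphism. -/
theorem exists_unit_conj_eq (j : L →ₐ[F] C)
    (hC : Module.finrank F C = Module.finrank F L ^ 2) (σ : Gal(L/F)) :
    ∃ u : Cˣ, ∀ y, (u : C) * j y = j (σ y) * u := by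
  classical
  obtain ⟨w, hw, hw0⟩ := exists_ne_zero_mem_twistedCentralizer j σ
  suffices h : IsUnit w by
    obtain ⟨u, rfl⟩ := h
    exact ⟨u, hw⟩
  have : IsNoetherianRing C := IsNoetherianRing.of_finite F C
  let p : Gal(L/F) → C → C := fun τ v => bimoduleAction j (galoisIdem τ) v
  have hp : ∀ τ v, p τ v ∈ twistedCentralizer j τ := galoisIdem_mem_twistedCentralizer j
  have hne : ∃ a b : C, p 1 (a * w * b) ≠ 0 := by
    by_contra! hcon
    have hzero : ∀ t, p 1 (AlgHom.mulLeftRight F C t w) = 0 := by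
      intro t
      induction t with
      | zero => simp [p]
      | add a b ha hb => simpa [p] using by simp_all [p]
      | tmul a b => simpa using hcon a b.unop
    obtain ⟨f, hf⟩ : ∃ f : Module.End F C, f w = 1 := by
      obtain ⟨φ, hφ⟩ := Module.Projective.exists_dual_ne_zero F hw0
      refine ⟨LinearMap.smulRight φ ((φ w)⁻¹ • (1 : C)), ?_⟩
      simp [smul_smul, hφ]
    obtain ⟨t, rfl⟩ := mulLeftRight_bijective.2 f
    have h1 := hzero t
    rw [hf] at h1
    have h2 : p 1 1 = 1 := galoisIdem_apply_self _ 1 _ (by simp [bimoduleAction_tmul])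
    exact one_ne_zero (h2.symm.trans h1)
  obtain ⟨a, b, hab⟩ := hne
  obtain ⟨α, β, hαβ⟩ : ∃ α β, p 1 (p α a * w * p β b) ≠ 0 := by
    by_contra! hcon
    apply hab
    have ha := sum_galoisIdem_apply (bimoduleAction j) a
    have hb := sum_galoisIdem_apply (bimoduleAction j) b
    rw [← ha, ← hb, Finset.sum_mul, Finset.sum_mul]
    simp_rw [Finset.mul_sum]
    change bimoduleAction j (galoisIdem 1) _ = 0
    rw [map_sum]
    refine Finset.sum_eq_zero fun α _ => ?_
    rw [map_sum]
    exact Finset.sum_eq_zero fun β _ => hcon α β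
  have hmem := mul_mem_twistedCentralizer (mul_mem_twistedCentralizer (hp α a) hw) (hp β b)
  have h1 : α * σ * β = 1 := by
    by_contra hne
    exact hαβ (galoisIdem_apply_of_ne _ hne _
      (mem_twistedCentralizer_iff_bimoduleAction.1 hmem))
  rw [h1] at hmem
  obtain ⟨x, hx⟩ := mem_range_of_forall_commute j hC fun y => by simpa using hmem y
  replace hx : j x = p α a * w * p β b := hx
  have hx0 : x ≠ 0 := by
    rintro rfl
    rw [map_zero] at hx
    apply hαβ
    rw [← hx]
    simp [p]
  have h2 : p α a * (w * (p β b * j x⁻¹)) = 1 := by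
    calc p α a * (w * (p β b * j x⁻¹)) = p α a * w * p β b * j x⁻¹ := by simp only [mul_assoc]
      _ = 1 := by rw [← hx, ← map_mul, mul_inv_cancel₀ hx0, map_one]
  rw [mul_eq_one_comm, mul_assoc] at h2
  exact IsUnit.of_mul_eq_one _ h2

end

section

variable {F L C : Type*} [Field F] [Field L] [Algebra F L] [Ring C] [Algebra F C]

theorem pow_mul_of_mul_eq {j : L →ₐ[F] C} {σ : Gal(L/F)} {u : C}
    (hu : ∀ y, u * j y = j (σ y) * u) (k : ℕ) (y : L) :
    u ^ k * j y = j ((σ ^ k) y) * u ^ k := by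
  induction k generalizing y with
  | zero => simp
  | succ k ih => rw [pow_succ, mul_assoc, hu, ← mul_assoc, ih, mul_assoc, pow_succ σ,
      AlgEquiv.mul_apply]

theorem mem_range_algebraMap_of_forall_zpowers [FiniteDimensional F L] [IsGalois F L]
    {σ : Gal(L/F)} (hσ : ∀ τ : Gal(L/F), τ ∈ Subgroup.zpowers σ) {x : L} (hx : σ x = x) :
    ∃ a : F, algebraMap F L a = x := by
  refine (IsGalois.mem_range_algebraMap_iff_fixed x).2 fun τ => ?_
  have : Subgroup.zpowers σ ≤ MulAction.stabilizer Gal(L/F) x := by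
    rw [Subgroup.zpowers_le]
    exact hx
  exact this (hσ τ)

theorem orderOf_eq_finrank [FiniteDimensional F L] [IsGalois F L]
    {σ : Gal(L/F)} (hσ : ∀ τ : Gal(L/F), τ ∈ Subgroup.zpowers σ) :
    orderOf σ = Module.finrank F L := by
  rw [← IsGalois.card_aut_eq_finrank]
  exact orderOf_eq_card_of_forall_mem_zpowers hσ

/-- A central simple algebra with a cyclic maximal subfield `L` is generated by `L` and a unit `u`
inducing a generator of the Galois group, with `u ^ [L : F]` a scalar. -/
theorem exists_unit_pow_eq_algebraMap [FiniteDimensional F L] [IsGalois F L]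
    [Algebra.IsCentral F C] [IsSimpleRing C] [FiniteDimensional F C] (j : L →ₐ[F] C)
    (hC : Module.finrank F C = Module.finrank F L ^ 2) {σ : Gal(L/F)}
    (hσ : ∀ τ : Gal(L/F), τ ∈ Subgroup.zpowers σ) :
    ∃ (u : Cˣ) (b : F), b ≠ 0 ∧ (∀ y, (u : C) * j y = j (σ y) * u) ∧
      (u : C) ^ Module.finrank F L = algebraMap F C b := by
  obtain ⟨u, hu⟩ := exists_unit_conj_eq j hC σ
  have hj : Function.Injective j := j.toRingHom.injective
  have hN : σ ^ Module.finrank F L = 1 := by rw [← orderOf_eq_finrank hσ, pow_orderOf_eq_one]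
  obtain ⟨x, hx⟩ := mem_range_of_forall_commute j hC (v := (u : C) ^ Module.finrank F L)
    fun y => by rw [pow_mul_of_mul_eq hu, hN, AlgEquiv.one_apply]
  replace hx : j x = (u : C) ^ Module.finrank F L := hx
  have hσx : σ x = x := by
    apply hj
    have h := hu x
    rw [hx, ← pow_succ', pow_succ, ← hx] at h
    exact (u.mul_left_inj.1 h).symm
  obtain ⟨b, rfl⟩ := mem_range_algebraMap_of_forall_zpowers hσ hσx
  rw [j.commutes] at hx
  refine ⟨u, b, ?_, hu, hx.symm⟩
  rintro rfl
  rw [map_zero, ← Units.val_pow_eq_pow_val] at hx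
  exact (u ^ Module.finrank F L).ne_zero hx.symm

/-- If the `(q + 1)`-fold tensor power of the cyclic algebra `(L, σ, b)` acts on a space of the
smallest possible dimension, then `b ^ (q + 1)` is a norm from `L`. -/
theorem exists_prod_eq_pow [FiniteDimensional F L] [IsGalois F L]
    [Algebra.IsCentral F C] [IsSimpleRing C] [FiniteDimensional F C] (j : L →ₐ[F] C)
    (hC : Module.finrank F C = Module.finrank F L ^ 2) {σ : Gal(L/F)}
    {u : Cˣ} {b : F} (hu : ∀ y, (u : C) * j y = j (σ y) * u)
    (hub : (u : C) ^ Module.finrank F L = algebraMap F C b)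
    {V : Type*} [AddCommGroup V] [Module F V] [FiniteDimensional F V] (q : ℕ)
    (hV : Module.finrank F V = Module.finrank F L ^ (q + 1))
    (φ : (⨂[F] _ : Fin (q + 1), C) →ₐ[F] Module.End F V) :
    ∃ x : L, ∏ k ∈ Finset.range (Module.finrank F L), (σ ^ k) x =
      algebraMap F L (b ^ (q + 1)) := by
  classical
  have hNpos : 0 < Module.finrank F L := Module.finrank_pos
  let s : Fin (q + 1) → C →ₐ[F] Module.End F V := fun i =>
    φ.comp (PiTensorProduct.singleAlgHom (R := F) (A := fun _ => C) i)
  have hs : ∀ i k, i ≠ k → ∀ x y : C, Commute (s i x) (s k y) := fun i k hik x y =>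
    (Commute.tprod (R := F)
      (Pi.mulSingle_commute (f := fun _ : Fin (q + 1) => C) hik x y)).map φ
  let ρ : Fin (q + 1) → L →ₐ[F] Module.End F V := fun i => (s i).comp j
  choose U hU using exists_unit_conj_eq j hC
  have hfin := finrank_iInf_coincidence ρ (fun i τ => s i (U τ)) (fun i τ => s i ↑(U τ)⁻¹)
    (fun i k hik x y => hs i k hik _ _) (fun i k hik x τ => hs i k hik _ _)
    (fun i k hik x τ => hs i k hik _ _) (fun i τ => by rw [← map_mul, Units.mul_inv, map_one])
    (fun i τ => by rw [← map_mul, Units.inv_mul, map_one])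
    (fun i τ y => by
      change s i (U τ) * s i (j y) = s i (j (τ y)) * s i (U τ)
      rw [← map_mul, ← map_mul, hU]) 0 (Finset.univ.erase 0) (by simp)
  rw [hV, Finset.card_erase_of_mem (Finset.mem_univ _), Finset.card_univ, Fintype.card_fin,
    Nat.add_sub_cancel, pow_succ', Nat.mul_left_inj (pow_pos hNpos q).ne'] at hfin
  set W := ⨅ i ∈ Finset.univ.erase (0 : Fin (q + 1)), coincidence (ρ 0) (ρ i) with hW
  have hmem : ∀ v, v ∈ W ↔ ∀ i y, ρ i y v = ρ 0 y v := by
    intro v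
    simp only [hW, Submodule.mem_iInf, Finset.mem_erase, Finset.mem_univ, and_true,
      mem_coincidence]
    refine ⟨fun h i y => ?_, fun h i _ y => h i y⟩
    by_cases hi : i = 0
    · rw [hi]
    · exact h i hi y
  have hρ : ∀ i k x y, Commute (ρ i x) (ρ k y) := by
    intro i k x y
    by_cases hik : i = k
    · subst hik
      exact (Commute.all x y).map (ρ i)
    · exact hs i k hik _ _
  obtain ⟨w, hw, hw0⟩ := W.exists_mem_ne_zero_of_ne_bot fun h => by
    rw [h, finrank_bot] at hfin
    omega
  have hρW : ∀ x, ∀ v ∈ W, ρ 0 x v ∈ W := fun x v hv => (hmem _).2 fun i y => by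
    rw [← Module.End.mul_apply, (hρ i 0 y x).eq, Module.End.mul_apply, (hmem v).1 hv,
      ← Module.End.mul_apply, (hρ 0 0 x y).eq, Module.End.mul_apply]
  have hinj : ∀ x, ρ 0 x w = 0 → x = 0 := by
    intro x hx
    by_contra hx0
    apply hw0
    calc w = (ρ 0 (x⁻¹ * x)) w := by rw [inv_mul_cancel₀ hx0, map_one, Module.End.one_apply]
      _ = 0 := by rw [map_mul, Module.End.mul_apply, hx, map_zero]
  let f : L →ₗ[F] W := LinearMap.codRestrict W ((LinearMap.applyₗ w).comp (ρ 0).toLinearMap)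
    fun x => hρW x w hw
  have hf : Function.Injective f := (injective_iff_map_eq_zero f).2 fun x hx =>
    hinj x (congrArg Subtype.val hx)
  have hfs : Function.Surjective f :=
    (LinearMap.injective_iff_surjective_of_finrank_eq_finrank hfin.symm).1 hf
  let P : Module.End F V := φ (PiTensorProduct.tprod F fun _ => (u : C))
  have hP : ∀ i y, P * ρ i y = ρ i (σ y) * P := by
    intro i y
    change φ _ * φ (PiTensorProduct.tprod F (Pi.mulSingle i (j y))) =
      φ (PiTensorProduct.tprod F (Pi.mulSingle i (j (σ y)))) * φ _
    rw [← map_mul φ, ← map_mul φ, PiTensorProduct.tprod_mul_tprod,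
      PiTensorProduct.tprod_mul_tprod]
    congr 2
    funext k
    by_cases hik : k = i
    · subst hik
      simpa using hu y
    · simp [Pi.mulSingle_eq_of_ne hik]
  have hP' : ∀ i y v, P (ρ i y v) = ρ i (σ y) (P v) := fun i y v =>
    LinearMap.congr_fun (hP i y) v
  have hPw : P w ∈ W := (hmem _).2 fun i y => by
    have h := congrArg P ((hmem w).1 hw i (σ.symm y))
    rwa [hP', hP', AlgEquiv.apply_symm_apply] at h
  obtain ⟨x, hx⟩ := hfs ⟨P w, hPw⟩
  replace hx : ρ 0 x w = P w := congrArg Subtype.val hx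
  have hpow : ∀ k, (P ^ k) w = ρ 0 (∏ i ∈ Finset.range k, (σ ^ i) x) w := by
    intro k
    induction k with
    | zero => simp
    | succ k ih =>
      rw [pow_succ', Module.End.mul_apply, ih, hP', ← hx, ← Module.End.mul_apply, ← map_mul,
        Finset.prod_range_succ', map_prod]
      simp [pow_succ', AlgEquiv.mul_apply]
  have hPN : P ^ Module.finrank F L = algebraMap F _ (b ^ (q + 1)) := by
    change φ _ ^ _ = _
    have h1 : (PiTensorProduct.tprod F fun _ : Fin (q + 1) => (u : C)) ^ Module.finrank F L =
        PiTensorProduct.tprod F ((fun _ => (u : C)) ^ Module.finrank F L) :=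
      (map_pow (PiTensorProduct.tprodMonoidHom (A := fun _ : Fin (q + 1) => C) F) _ _).symm
    have h2 : (fun _ : Fin (q + 1) => (u : C)) ^ Module.finrank F L = fun _ => b • (1 : C) := by
      funext i
      rw [Pi.pow_apply, hub, Algebra.algebraMap_eq_smul_one]
    rw [← map_pow, h1, h2, MultilinearMap.map_smul_univ, map_smul, Finset.prod_const,
      Finset.card_univ, Fintype.card_fin, Algebra.algebraMap_eq_smul_one]
    congr 1
    exact map_one φ
  refine ⟨x, sub_eq_zero.1 (hinj _ ?_)⟩
  rw [map_sub, LinearMap.sub_apply, ← hpow, hPN, (ρ 0).commutes, sub_self]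

theorem finrank_piTensorProduct {ι : Type*} [Fintype ι] (A : ι → Type*)
    [∀ i, AddCommGroup (A i)] [∀ i, Module F (A i)] [∀ i, FiniteDimensional F (A i)] :
    Module.finrank F (⨂[F] i, A i) = ∏ i, Module.finrank F (A i) := by
  classical
  rw [Module.finrank_eq_card_basis (Basis.piTensorProduct fun i => Module.finBasis F (A i)),
    Fintype.card_pi]
  simp

end

section

variable {F L : Type*} [Field F] [Field L] [Algebra F L]

/-- Hilbert's Theorem 90 for the cyclic group generated by an automorphism. -/
theorem exists_mul_apply_eq_of_prod_eq_one {τ : Gal(L/F)} {q : ℕ} (hq : 0 < q)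
    (hτ : orderOf τ = q) {x : L} (hx : ∏ i ∈ Finset.range q, (τ ^ i) x = 1) :
    ∃ y : L, y ≠ 0 ∧ x * τ y = y := by
  let c : ℕ → L := fun k => ∏ i ∈ Finset.range k, (τ ^ i) x
  have hli : LinearIndependent L fun k : Fin q => ((τ ^ (k : ℕ) : Gal(L/F)) : L → L) := by
    have h := linearIndependent_monoidHom L L
    let f : Fin q → (L →* L) := fun k => ((τ ^ (k : ℕ) : Gal(L/F)) : L →* L)
    refine h.comp f fun a b hab => Fin.ext ?_
    have h1 : τ ^ (a : ℕ) = τ ^ (b : ℕ) := AlgEquiv.ext fun z => DFunLike.congr_fun hab z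
    exact pow_injOn_Iio_orderOf (by simp [hτ]) (by simp [hτ]) h1
  obtain ⟨θ, hθ⟩ : ∃ θ, ∑ k ∈ Finset.range q, c k * (τ ^ k) θ ≠ 0 := by
    by_contra! hcon
    rw [Fintype.linearIndependent_iff] at hli
    have h0 := hli (fun k => c k) (funext fun z => by
      rw [Finset.sum_apply]
      exact (Fin.sum_univ_eq_sum_range (fun k => c k * (τ ^ k) z) q).trans (hcon z))
      ⟨0, hq⟩
    simp [c] at h0
  refine ⟨_, hθ, ?_⟩
  have h1 : ∀ k, x * τ (c k * (τ ^ k) θ) = c (k + 1) * (τ ^ (k + 1)) θ := by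
    intro k
    simp only [c, Finset.prod_range_succ', map_mul, map_prod, pow_succ', AlgEquiv.mul_apply,
      pow_zero, AlgEquiv.one_apply]
    ring
  rw [map_sum, Finset.mul_sum, Finset.sum_congr rfl fun k _ => h1 k]
  have h2 := Finset.sum_range_succ (fun k => c k * (τ ^ k) θ) q
  rw [Finset.sum_range_succ'] at h2
  have h3 : c q * (τ ^ q) θ = c 0 * (τ ^ 0) θ := by
    have hcq : c q = 1 := hx
    have hτq : τ ^ q = 1 := by rw [← hτ, pow_orderOf_eq_one]
    rw [hcq, hτq]
    simp [c]
  rw [h3] at h2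
  exact add_right_cancel h2

theorem apply_prod_range_mul (σ : Gal(L/F)) (m : ℕ) (x : L) :
    x * σ (∏ k ∈ Finset.range m, (σ ^ k) x) = (∏ k ∈ Finset.range m, (σ ^ k) x) * (σ ^ m) x := by
  rw [← Finset.prod_range_succ, Finset.prod_range_succ', map_prod, mul_comm]
  simp [pow_succ', AlgEquiv.mul_apply]

theorem prod_range_mul_eq_prod_prod (σ : Gal(L/F)) (m q : ℕ) (x : L) :
    ∏ k ∈ Finset.range (m * q), (σ ^ k) x =
      ∏ i ∈ Finset.range q, ((σ ^ m) ^ i) (∏ k ∈ Finset.range m, (σ ^ k) x) := by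
  induction q with
  | zero => simp
  | succ q ih =>
    rw [Nat.mul_succ, Finset.prod_range_add, ih, Finset.prod_range_succ, map_prod]
    simp [pow_add, pow_mul, AlgEquiv.mul_apply]

/-- If `b ^ p` is a norm from a cyclic extension of degree `m * p`, then `b` is a norm from the
subextension of degree `m`. -/
theorem exists_fixed_prod_eq {σ : Gal(L/F)} {m p : ℕ} (hm : 0 < m) (hp : 0 < p)
    (hσ : orderOf σ = m * p) {b : F} (hb : b ≠ 0) {x : L}
    (hx : ∏ k ∈ Finset.range (m * p), (σ ^ k) x = algebraMap F L (b ^ p)) :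
    ∃ c : L, (σ ^ m) c = c ∧ ∏ k ∈ Finset.range m, (σ ^ k) c = algebraMap F L b := by
  have hb' : algebraMap F L b ≠ 0 := by simpa using hb
  have hord : orderOf (σ ^ m) = p := by
    rw [orderOf_pow_of_dvd hm.ne' (by rw [hσ]; exact dvd_mul_right m p), hσ,
      Nat.mul_div_cancel_left _ hm]
  obtain ⟨y, hy, hxy⟩ := exists_mul_apply_eq_of_prod_eq_one hp hord
    (x := (∏ k ∈ Finset.range m, (σ ^ k) x) / algebraMap F L b) (by
      simp_rw [map_div₀]
      rw [Finset.prod_div_distrib, ← prod_range_mul_eq_prod_prod, hx]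
      simp [AlgEquiv.commutes, hb])
  have hprod : ∏ k ∈ Finset.range m, (σ ^ k) (x * (σ y / y)) = algebraMap F L b := by
    have htel : ∀ k, ∏ i ∈ Finset.range k, (σ ^ i) (σ y / y) = (σ ^ k) y / y := by
      intro k
      induction k with
      | zero => simp [hy]
      | succ k ih =>
        have hk : (σ ^ k) y ≠ 0 := (map_ne_zero _).2 hy
        rw [Finset.prod_range_succ, ih, map_div₀, pow_succ, AlgEquiv.mul_apply]
        field_simp
    rw [Finset.prod_congr rfl fun k _ => map_mul (σ ^ k) x (σ y / y), Finset.prod_mul_distrib, htel]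
    field_simp at hxy ⊢
    exact hxy
  refine ⟨_, ?_, hprod⟩
  have h := apply_prod_range_mul σ m (x * (σ y / y))
  rw [hprod, AlgEquiv.commutes, mul_comm, mul_right_inj' hb'] at h
  exact h.symm

end

section

open MvPolynomial

variable {F L ι : Type*} [Field F] [Field L] [Algebra F L]

/-- The ideal generated by the polynomials `X i ^ p - f i`. -/
noncomputable def radicalIdeal (p : ℕ) (f : ι → L) : Ideal (MvPolynomial ι L) :=
  Ideal.span (Set.range fun i => X i ^ p - C (f i))

/-- The algebra obtained from `L` by formally adjoining `p`-th roots of the elements `f i`. -/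
abbrev RadicalRing (p : ℕ) (f : ι → L) : Type _ := MvPolynomial ι L ⧸ radicalIdeal p f

namespace RadicalRing

variable {p : ℕ} {f : ι → L}

variable (p f) in
/-- The adjoined root of `f i`. -/
noncomputable def root (i : ι) : RadicalRing p f := Ideal.Quotient.mk _ (X i)

theorem root_pow (i : ι) : root p f i ^ p = algebraMap L _ (f i) := by
  rw [root, ← map_pow]
  exact Ideal.Quotient.eq.2 (Ideal.subset_span ⟨i, rfl⟩)

@[elab_as_elim]
theorem induction {P : RadicalRing p f → Prop} (t : RadicalRing p f)
    (halg : ∀ x, P (algebraMap L _ x)) (hadd : ∀ s t, P s → P t → P (s + t))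
    (hmul : ∀ i t, P t → P (root p f i * t)) : P t := by
  obtain ⟨q, rfl⟩ := Ideal.Quotient.mk_surjective t
  induction q using MvPolynomial.induction_on with
  | C a => exact halg a
  | add q r hq hr => rw [map_add]; exact hadd _ _ hq hr
  | mul_X q i hq => rw [map_mul, mul_comm]; exact hmul i _ hq

/-- The automorphism of `L` fixing the `f i` extends to the radical ring. -/
noncomputable def map (τ : L →ₐ[F] L) (hτ : ∀ i, τ (f i) = f i) :
    RadicalRing p f →ₐ[F] RadicalRing p f :=
  Ideal.quotientMapₐ _ (MvPolynomial.mapAlgHom τ) (by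
    rw [radicalIdeal, Ideal.span_le]
    rintro _ ⟨i, rfl⟩
    refine Ideal.subset_span ⟨i, ?_⟩
    simp [hτ])

theorem map_root (τ : L →ₐ[F] L) (hτ : ∀ i, τ (f i) = f i) (i : ι) :
    map τ hτ (root p f i) = root p f i := by
  change Ideal.Quotient.mk _ (MvPolynomial.mapAlgHom τ (X i)) = _
  simp [root]

theorem map_algebraMap (τ : L →ₐ[F] L) (hτ : ∀ i, τ (f i) = f i) (x : L) :
    map (p := p) τ hτ (algebraMap L _ x) = algebraMap L _ (τ x) := by
  change Ideal.Quotient.mk _ (MvPolynomial.mapAlgHom τ (C x)) = _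
  rw [mapAlgHom_apply, MvPolynomial.map_C]
  rfl

theorem isUnit_root (hp : p ≠ 0) (hf : ∀ i, f i ≠ 0) (i : ι) : IsUnit (root p f i) := by
  rw [← isUnit_pow_iff hp, root_pow]
  exact (hf i).isUnit.map _

instance [Finite ι] [NeZero p] : Module.Finite L (RadicalRing p f) := by
  have : Algebra.FiniteType L (RadicalRing p f) :=
    Algebra.FiniteType.of_surjective (Ideal.Quotient.mkₐ L _) Ideal.Quotient.mk_surjective
  have : Algebra.IsIntegral L (RadicalRing p f) := ⟨fun t => by
    induction t using RadicalRing.induction with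
    | halg x => exact isIntegral_algebraMap
    | hadd s t hs ht => exact hs.add ht
    | hmul i t ht =>
      refine IsIntegral.mul (IsIntegral.of_pow (NeZero.pos p) ?_) ht
      rw [root_pow]
      exact isIntegral_algebraMap⟩
  exact Algebra.IsIntegral.finite

section

variable [Fintype ι]

variable (p f) in
/-- The monomials in the adjoined roots. -/
noncomputable def monomial (α : ι → ℕ) : RadicalRing p f := ∏ i, root p f i ^ α i

theorem root_mul_monomial [DecidableEq ι] (i : ι) (α : ι → ℕ) :
    root p f i * monomial p f α = monomial p f (α + Pi.single i 1) := by
  simp only [monomial, Pi.add_apply, pow_add, Finset.prod_mul_distrib, Pi.single_apply]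
  simp [mul_comm]

theorem span_monomial : Submodule.span L (Set.range (monomial p f)) = ⊤ := by
  classical
  refine Submodule.eq_top_iff'.2 fun t => ?_
  induction t using RadicalRing.induction with
  | halg x =>
    rw [Algebra.algebraMap_eq_smul_one]
    exact Submodule.smul_mem _ _ (Submodule.subset_span ⟨0, by simp [monomial]⟩)
  | hadd s t hs ht => exact add_mem hs ht
  | hmul i t ht =>
    induction ht using Submodule.span_induction with
    | mem x hx =>
      obtain ⟨α, rfl⟩ := hx
      exact Submodule.subset_span ⟨_, (root_mul_monomial i α).symm⟩
    | zero => simp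
    | add x y _ _ hx hy => rw [mul_add]; exact add_mem hx hy
    | smul a x _ hx => rw [mul_smul_comm]; exact Submodule.smul_mem _ _ hx

theorem pow_card_le_finrank [NeZero p] (hf : ∀ i, f i ≠ 0) :
    p ^ Fintype.card ι ≤ Module.finrank L (RadicalRing p f) := by
  classical
  let Ω := AlgebraicClosure L
  choose r hr using fun i => IsAlgClosed.exists_pow_nat_eq (algebraMap L Ω (f i)) (NeZero.pos p)
  have hr0 : ∀ i, r i ≠ 0 := fun i h => by
    have := hr i
    rw [h, zero_pow (NeZero.ne p)] at this
    exact hf i (by simpa using this.symm)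
  let y : ι → AddMonoidAlgebra Ω (ι → ZMod p) := fun i =>
    AddMonoidAlgebra.single (Pi.single i 1) (r i)
  have hy : ∀ i (k : ℕ), y i ^ k = AddMonoidAlgebra.single (k • Pi.single i 1) (r i ^ k) :=
    fun i k => AddMonoidAlgebra.single_pow _ _ _
  let φ : RadicalRing p f →ₐ[L] AddMonoidAlgebra Ω (ι → ZMod p) :=
    Ideal.Quotient.liftₐ _ (MvPolynomial.aeval y) (by
      intro a ha
      refine (RingHom.mem_ker (f := (MvPolynomial.aeval y).toRingHom)).1 ?_
      refine Ideal.span_le.2 ?_ ha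
      rintro _ ⟨i, rfl⟩
      have h0 : p • (Pi.single i 1 : ι → ZMod p) = 0 := by
        ext k
        simp
      change MvPolynomial.aeval y (X i ^ p - C (f i)) = 0
      rw [map_sub, map_pow, MvPolynomial.aeval_X, hy, h0, hr, sub_eq_zero]
      simp)
  have hφ : ∀ i, φ (root p f i) = y i := fun i => MvPolynomial.aeval_X y i
  let M : (ι → ZMod p) → RadicalRing p f := fun α => monomial p f fun i => (α i).val
  have hM : ∀ α, φ (M α) = AddMonoidAlgebra.single α (∏ i, r i ^ (α i).val) := by
    intro α
    simp only [M, monomial, map_prod, map_pow, hφ, hy]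
    rw [AddMonoidAlgebra.prod_single]
    congr 1
    funext k
    rw [Finset.sum_apply, Finset.sum_eq_single k]
    · rw [Pi.smul_apply, Pi.single_eq_same, nsmul_one, ZMod.natCast_zmod_val]
    · intro i _ hik
      rw [Pi.smul_apply, Pi.single_eq_of_ne hik.symm, smul_zero]
    · simp
  have hli : LinearIndependent L M := by
    refine LinearIndependent.of_comp φ.toLinearMap ?_
    refine Fintype.linearIndependent_iff.2 fun g hg β => ?_
    have h : ∑ α, AddMonoidAlgebra.single α (g α • ∏ i, r i ^ (α i).val) = 0 := by
      simpa [Function.comp_def, hM] using hg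
    have hβ := DFunLike.congr_fun (congrArg AddMonoidAlgebra.coeff h) β
    have hr : ∏ i, r i ^ (β i).val ≠ 0 :=
      Finset.prod_ne_zero_iff.2 fun i _ => pow_ne_zero _ (hr0 i)
    simpa [Finsupp.single_apply, hr, hr0] using hβ
  have := hli.fintype_card_le_finrank
  simpa [ZMod.card] using this

end

variable [CharP L p]

theorem mk_smul_pderiv_eq_zero (i : ι) (q : MvPolynomial ι L)
    (hq : Ideal.Quotient.mkₐ L (radicalIdeal p f) q = 0) :
    Ideal.Quotient.mkₐ L (radicalIdeal p f) (((X i : MvPolynomial ι L) • pderiv i) q) = 0 := by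
  replace hq : q ∈ radicalIdeal p f := Ideal.Quotient.eq_zero_iff_mem.1 hq
  refine Ideal.Quotient.eq_zero_iff_mem.2 ?_
  refine Submodule.span_induction (p := fun q _ =>
    ((X i : MvPolynomial ι L) • pderiv i) q ∈ radicalIdeal p f) ?_ ?_ ?_ ?_ hq
  · rintro _ ⟨j, rfl⟩
    have : ((X i : MvPolynomial ι L) • pderiv i) (X j ^ p - C (f j)) = 0 := by
      simp [Derivation.leibniz_pow]
    simp [this]
  · simp
  · intro a b _ _ ha hb
    rw [map_add]
    exact add_mem ha hb
  · intro a b hb hb'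
    rw [smul_eq_mul, Derivation.leibniz]
    exact add_mem (Ideal.mul_mem_left _ _ hb') (Ideal.mul_mem_right _ _ hb)

variable (p f) in
/-- The Euler derivation `Y_i ∂/∂Y_i`. -/
noncomputable def euler (i : ι) : Derivation L (RadicalRing p f) (RadicalRing p f) :=
  Derivation.liftOfSurjective (f := Ideal.Quotient.mkₐ L (radicalIdeal p f))
    (d := (X i : MvPolynomial ι L) • pderiv i) Ideal.Quotient.mk_surjective
    (mk_smul_pderiv_eq_zero i)

theorem euler_mk (i : ι) (q : MvPolynomial ι L) :
    euler p f i (Ideal.Quotient.mk _ q) = Ideal.Quotient.mk _ (X i * pderiv i q) :=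
  Derivation.liftOfSurjective_apply (f := Ideal.Quotient.mkₐ L (radicalIdeal p f))
    Ideal.Quotient.mk_surjective (mk_smul_pderiv_eq_zero i) q

theorem euler_root [DecidableEq ι] (i j : ι) :
    euler p f i (root p f j) = (if j = i then (1 : L) else 0) • root p f j := by
  rw [root, euler_mk]
  by_cases h : j = i
  · subst h
    simp
  · simp [h, pderiv_X_of_ne h]

theorem euler_root_mul [DecidableEq ι] (i j : ι) (t : RadicalRing p f) :
    euler p f i (root p f j * t) =
      root p f j * (euler p f i t + (if j = i then (1 : L) else 0) • t) := by
  rw [Derivation.leibniz, euler_root, smul_eq_mul, smul_eq_mul, mul_add, mul_smul_comm,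
    mul_smul_comm, mul_comm t]

theorem euler_comm (i j : ι) (t : RadicalRing p f) :
    euler p f i (euler p f j t) = euler p f j (euler p f i t) := by
  classical
  induction t using RadicalRing.induction with
  | halg x => simp
  | hadd s t hs ht => simp [hs, ht]
  | hmul k t ht =>
    simp only [euler_root_mul, map_add, ht, Derivation.map_smul]
    congr 1
    module

theorem map_euler (τ : L →ₐ[F] L) (hτ : ∀ i, τ (f i) = f i) (i : ι) (t : RadicalRing p f) :
    map τ hτ (euler p f i t) = euler p f i (map τ hτ t) := by
  classical
  induction t using RadicalRing.induction with
  | halg x => simp [map_algebraMap]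
  | hadd s t hs ht => simp [hs, ht]
  | hmul k t ht =>
    rw [euler_root_mul, map_mul, map_mul, map_root, euler_root_mul, map_add, ht]
    split_ifs <;> simp

variable [Fintype ι]

theorem euler_monomial (i : ι) (α : ι → ℕ) :
    euler p f i (monomial p f α) = (α i : L) • monomial p f α := by
  classical
  have hmul : ∀ (j : ι) (n : ℕ) (t : RadicalRing p f), euler p f i (root p f j ^ n * t) =
      root p f j ^ n * (euler p f i t + (if j = i then (n : L) else 0) • t) := by
    intro j n t
    induction n with
    | zero => simp
    | succ n ih =>
      rw [pow_succ', mul_assoc, euler_root_mul, ih, mul_assoc, ← mul_smul_comm, ← mul_add]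
      congr 2
      split_ifs <;> (push_cast; module)
  have hs : ∀ s : Finset ι, euler p f i (∏ j ∈ s, root p f j ^ α j) =
      (if i ∈ s then (α i : L) else 0) • ∏ j ∈ s, root p f j ^ α j := by
    intro s
    induction s using Finset.induction_on with
    | empty => simp
    | insert j s hj ih =>
      rw [Finset.prod_insert hj, hmul, ih, ← add_smul, mul_smul_comm]
      congr 1
      by_cases hij : j = i
      · subst hij
        simp [hj]
      · simp [hij, Ne.symm hij]
  simpa [monomial] using hs Finset.univ

/-- The joint kernel of the Euler derivations is `L`. -/
theorem mem_range_algebraMap_of_euler_eq_zero [hp : Fact p.Prime] {t : RadicalRing p f}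
    (ht : ∀ i, euler p f i t = 0) : ∃ x, algebraMap L _ x = t := by
  classical
  have key : ∀ s : Finset ι,
      t ∈ Submodule.span L (monomial p f '' {α | ∀ i ∈ s, p ∣ α i}) := by
    intro s
    induction s using Finset.induction_on with
    | empty => simp [span_monomial]
    | insert i s hi ih =>
      let g : Module.End L (RadicalRing p f) := 1 - (euler p f i).toLinearMap ^ (p - 1)
      have hp1 : p - 1 ≠ 0 := by have := hp.out.two_le; omega
      have hgt : g t = t := by
        obtain ⟨k, hk⟩ := Nat.exists_eq_succ_of_ne_zero hp1
        have h0 : (euler p f i).toLinearMap t = 0 := ht i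
        simp [g, hk, pow_succ, h0]
      rw [← hgt]
      have hg := Submodule.mem_map_of_mem (f := g) ih
      rw [Submodule.map_span] at hg
      refine Submodule.span_le.2 ?_ hg
      rintro _ ⟨_, ⟨α, hα, rfl⟩, rfl⟩
      have hpow : ∀ k : ℕ, ((euler p f i).toLinearMap ^ k) (monomial p f α) =
          (α i : L) ^ k • monomial p f α := by
        intro k
        induction k with
        | zero => simp
        | succ k ih =>
          rw [pow_succ', Module.End.mul_apply, ih, map_smul, Derivation.coeFn_coe,
            euler_monomial, smul_smul, pow_succ]
      have hgα : g (monomial p f α) = (1 - (α i : L) ^ (p - 1)) • monomial p f α := by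
        simp [g, hpow, sub_smul]
      rw [SetLike.mem_coe, hgα]
      by_cases hpα : p ∣ α i
      · refine Submodule.smul_mem _ _ (Submodule.subset_span ⟨α, fun k hk => ?_, rfl⟩)
        rcases Finset.mem_insert.1 hk with rfl | hk
        · exact hpα
        · exact hα k hk
      · have hne : ((α i : ℕ) : ZMod p) ≠ 0 := fun h => hpα ((ZMod.natCast_eq_zero_iff _ _).1 h)
        have h1 : (α i : L) ^ (p - 1) = 1 := by
          have := congrArg (ZMod.castHom dvd_rfl L) (ZMod.pow_card_sub_one_eq_one hne)
          simpa using this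
        simp [h1]
  have h := key Finset.univ
  clear key ht
  induction h using Submodule.span_induction with
  | mem x hx =>
    obtain ⟨α, hα, rfl⟩ := hx
    refine ⟨∏ i, f i ^ (α i / p), ?_⟩
    rw [map_prod]
    refine Finset.prod_congr rfl fun i _ => ?_
    rw [map_pow, ← root_pow, ← pow_mul, Nat.mul_div_cancel' (hα i (Finset.mem_univ i))]
  | zero => exact ⟨0, map_zero _⟩
  | add x y _ _ hx hy =>
    obtain ⟨a, rfl⟩ := hx
    obtain ⟨b, rfl⟩ := hy
    exact ⟨a + b, map_add _ _ _⟩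
  | smul a x _ hx =>
    obtain ⟨b, rfl⟩ := hx
    exact ⟨a * b, (map_mul _ _ _).trans (Algebra.smul_def _ _).symm⟩

end RadicalRing

end

namespace RadicalRing

variable {L ι : Type*} [Field L] {p : ℕ} {f : ι → L} [CharP L p]

/-- The radical ring has no nontrivial ideals stable under the Euler derivations. -/
theorem eq_top_of_euler_mem [Fintype ι] [hp : Fact p.Prime] (hf : ∀ i, f i ≠ 0)
    (U : Ideal (RadicalRing p f)) (hU : ∀ i, ∀ t ∈ U, euler p f i t ∈ U) (hne : U ≠ ⊥) :
    U = ⊤ := by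
  classical
  choose y hy using isUnit_root hp.out.ne_zero hf
  let D : ι → Module.End L (RadicalRing p f) := fun i =>
    LinearMap.mulLeft L (↑(y i)⁻¹ : RadicalRing p f) * (euler p f i).toLinearMap
  have hD : ∀ i t, root p f i * D i t = euler p f i t := fun i t => by
    simp [D, ← hy]
  have hcancel : ∀ i s t, root p f i * s = root p f i * t → s = t := fun i s t h =>
    (isUnit_root hp.out.ne_zero hf i).mul_left_cancel h
  have hDne : ∀ i j, j ≠ i → ∀ t, D i (root p f j * t) = root p f j * D i t := by
    intro i j hij t
    apply hcancel i
    rw [hD, euler_root_mul, mul_left_comm, hD]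
    simp [hij]
  have hDself : ∀ i t, D i (root p f i * t) = root p f i * D i t + t := by
    intro i t
    apply hcancel i
    rw [hD, euler_root_mul, hD]
    simp
  have hnil : ∀ i t, ∃ r, (D i ^ r) t = 0 := by
    intro i t
    induction t using RadicalRing.induction with
    | halg x =>
      refine ⟨1, hcancel i _ _ ?_⟩
      rw [pow_one, hD, Derivation.map_algebraMap, mul_zero]
    | hadd s t hs ht =>
      obtain ⟨a, ha⟩ := hs
      obtain ⟨b, hb⟩ := ht
      refine ⟨a + b, ?_⟩
      rw [map_add, pow_add, Module.End.mul_apply, Module.End.mul_apply, hb, map_zero, add_zero,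
        ← Module.End.mul_apply, ← pow_add, add_comm, pow_add, Module.End.mul_apply, ha, map_zero]
    | hmul j t ht =>
      obtain ⟨r, hr⟩ := ht
      by_cases hij : j = i
      · subst hij
        refine ⟨r + 1, ?_⟩
        induction r generalizing t with
        | zero =>
          have : t = 0 := hr
          simp [this]
        | succ r ih =>
          rw [pow_succ, Module.End.mul_apply, hDself, map_add, hr, add_zero]
          exact ih (D j t) (by rw [← Module.End.mul_apply, ← pow_succ, hr])
      · have hcomm : ∀ k, (D i ^ k) (root p f j * t) = root p f j * (D i ^ k) t := by
          intro k
          induction k with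
          | zero => rfl
          | succ k ih =>
            rw [pow_succ', Module.End.mul_apply, ih, hDne i j hij]
            rfl
        exact ⟨r, by rw [hcomm, hr, mul_zero]⟩
  have hDU : ∀ i (r : ℕ), ∀ t ∈ U, (D i ^ r) t ∈ U := by
    intro i r t ht
    induction r with
    | zero => exact ht
    | succ r ih =>
      rw [pow_succ', Module.End.mul_apply]
      exact U.mul_mem_left _ (hU i _ ih)
  have hDker : ∀ i j, i ≠ j → ∀ (r : ℕ) t, euler p f j t = 0 → euler p f j ((D i ^ r) t) = 0 := by
    intro i j hij r t ht
    induction r with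
    | zero => exact ht
    | succ r ih =>
      rw [pow_succ', Module.End.mul_apply]
      apply hcancel i
      have h := euler_root_mul j i (D i ((D i ^ r) t))
      rw [hD, euler_comm, ih] at h
      simpa [hij] using h.symm
  have key : ∀ s : Finset ι, ∃ v ∈ U, v ≠ 0 ∧ ∀ i ∈ s, euler p f i v = 0 := by
    intro s
    induction s using Finset.induction_on with
    | empty =>
      obtain ⟨v, hv, hv0⟩ := Submodule.exists_mem_ne_zero_of_ne_bot hne
      exact ⟨v, hv, hv0, by simp⟩
    | insert i s hi ih =>
      obtain ⟨v, hv, hv0, hvs⟩ := ih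
      have hfind := Nat.find_spec (hnil i v)
      have hmin := fun k => Nat.find_min (hnil i v) (m := k)
      obtain ⟨r, hr⟩ := Nat.exists_eq_succ_of_ne_zero (n := Nat.find (hnil i v)) (by
        intro h
        rw [h] at hfind
        exact hv0 hfind)
      rw [hr] at hfind hmin
      refine ⟨(D i ^ r) v, hDU i r v hv, hmin r (Nat.lt_succ_self r), fun k hk => ?_⟩
      rcases Finset.mem_insert.1 hk with rfl | hk
      · rw [← hD, ← Module.End.mul_apply, ← pow_succ', hfind, mul_zero]
      · exact hDker i k (fun h => hi (h ▸ hk)) r v (hvs k hk)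
  obtain ⟨v, hv, hv0, hvs⟩ := key Finset.univ
  obtain ⟨x, rfl⟩ := mem_range_algebraMap_of_euler_eq_zero fun i => hvs i (Finset.mem_univ i)
  refine U.eq_top_of_isUnit_mem hv (IsUnit.map _ (IsUnit.mk0 x ?_))
  rintro rfl
  exact hv0 (map_zero _)

end RadicalRing

section

variable {F L R ι : Type*} [Field F] [Field L] [Algebra F L]

/-- Abstract properties of the radical ring of `f` over `L`: the lift `S` of `σ`, the adjoined
roots `Y i` and their Euler derivations `D i`. -/
structure IsRadicalExtension [CommRing R] [Algebra F R] [Algebra L R] (p : ℕ) (σ : Gal(L/F))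
    (S : R →ₐ[F] R) (Y : ι → R) (D : ι → Derivation L R R) (f : ι → F) : Prop where
  map_algebraMap : ∀ x, S (algebraMap L R x) = algebraMap L R (σ x)
  root_pow : ∀ i, Y i ^ p = algebraMap F R (f i)
  map_root : ∀ i, S (Y i) = Y i
  der_root_self : ∀ i, D i (Y i) = Y i
  der_root_of_ne : ∀ i j, j ≠ i → D i (Y j) = 0
  der_comm : ∀ i j t, D i (D j t) = D j (D i t)
  map_der : ∀ i t, S (D i t) = D i (S t)
  mem_range_of_der : ∀ t, (∀ i, D i t = 0) → ∃ x, algebraMap L R x = t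
  eq_top : ∀ U : Ideal R, (∀ i, ∀ t ∈ U, D i t ∈ U) → U ≠ ⊥ → U = ⊤
  induction : ∀ P : R → Prop, (∀ x, P (algebraMap L R x)) → (∀ s t, P s → P t → P (s + t)) →
    (∀ i t, P t → P (Y i * t)) → ∀ t, P t

theorem RadicalRing.isRadicalExtension [Fintype ι] {p : ℕ} [Fact p.Prime] [CharP L p]
    (σ : Gal(L/F)) (f : ι → F) (hf : ∀ i, f i ≠ 0) :
    IsRadicalExtension p σ
      (RadicalRing.map (p := p) (f := fun i => algebraMap F L (f i)) (σ : L →ₐ[F] L)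
        fun i => σ.commutes (f i))
      (RadicalRing.root p fun i => algebraMap F L (f i))
      (RadicalRing.euler p fun i => algebraMap F L (f i)) f := by
  classical
  refine ⟨RadicalRing.map_algebraMap _ _, fun i => ?_, RadicalRing.map_root _ _, fun i => ?_,
    fun i j hij => ?_, RadicalRing.euler_comm, RadicalRing.map_euler _ _,
    fun t => RadicalRing.mem_range_algebraMap_of_euler_eq_zero,
    RadicalRing.eq_top_of_euler_mem fun i => by simpa using hf i,
    fun P h1 h2 h3 t => RadicalRing.induction t h1 h2 h3⟩
  · rw [RadicalRing.root_pow, ← IsScalarTower.algebraMap_apply]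
  · simp [RadicalRing.euler_root]
  · simp [RadicalRing.euler_root, hij]

namespace IsRadicalExtension

variable [CommRing R] [Algebra F R] [Algebra L R] {p : ℕ} {σ : Gal(L/F)}
    {S : R →ₐ[F] R} {Y : ι → R} {D : ι → Derivation L R R} {f : ι → F}

theorem pow_map_algebraMap (h : IsRadicalExtension p σ S Y D f) (k : ℕ) (x : L) :
    (S ^ k) (algebraMap L R x) = algebraMap L R ((σ ^ k) x) := by
  induction k with
  | zero => rfl
  | succ k ih =>
    rw [pow_succ', AlgHom.mul_apply, ih, h.map_algebraMap, pow_succ', AlgEquiv.mul_apply]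

theorem pow_map_root (h : IsRadicalExtension p σ S Y D f) (k : ℕ) (i : ι) :
    (S ^ k) (Y i) = Y i := by
  induction k with
  | zero => rfl
  | succ k ih => rw [pow_succ', AlgHom.mul_apply, ih, h.map_root]

theorem pow_map_der (h : IsRadicalExtension p σ S Y D f) (k : ℕ) (i : ι) (t : R) :
    (S ^ k) (D i t) = D i ((S ^ k) t) := by
  induction k with
  | zero => rfl
  | succ k ih => rw [pow_succ', AlgHom.mul_apply, ih, h.map_der, AlgHom.mul_apply]

theorem pow_map_eq_one (h : IsRadicalExtension p σ S Y D f) {k : ℕ} (hk : σ ^ k = 1) (t : R) :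
    (S ^ k) t = t := by
  refine h.induction (fun t => (S ^ k) t = t) ?_ ?_ ?_ t
  · intro x
    rw [h.pow_map_algebraMap, hk, AlgEquiv.one_apply]
  · intro s t hs ht
    rw [map_add, hs, ht]
  · intro i t ht
    rw [map_mul, h.pow_map_root, ht]

variable (σ S) in
/-- Additive Hilbert 90: a preimage of `r` under `S - 1`, given `θ ∈ L` of trace one. -/
noncomputable def primitive (N : ℕ) (θ : L) (r : R) : R :=
  -∑ k ∈ Finset.range N, (∑ i ∈ Finset.range k, (S ^ i) r) * algebraMap L R ((σ ^ k) θ)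

theorem map_primitive (h : IsRadicalExtension p σ S Y D f) {N : ℕ} (hN : σ ^ N = 1) {θ : L}
    (hθ : ∑ k ∈ Finset.range N, (σ ^ k) θ = 1) {r : R}
    (hr : ∑ k ∈ Finset.range N, (S ^ k) r = 0) :
    S (primitive σ S N θ r) = primitive σ S N θ r + r := by
  let P : ℕ → R := fun k => ∑ i ∈ Finset.range k, (S ^ i) r
  let T : ℕ → R := fun k => algebraMap L R ((σ ^ k) θ)
  have hP : ∀ k, S (P k) = P (k + 1) - r := fun k => by
    simp only [P, map_sum, Finset.sum_range_succ' _ k, pow_succ', AlgHom.mul_apply, pow_zero,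
      AlgHom.one_apply, add_sub_cancel_right]
  have hT : ∀ k, S (T k) = T (k + 1) := fun k => by
    simp only [T, h.map_algebraMap, pow_succ', AlgEquiv.mul_apply]
  have hTN : T N = T 0 := by simp only [T, hN, pow_zero]
  have hPN : P N = 0 := hr
  have hP0 : P 0 = 0 := by simp [P]
  have hsum : ∑ k ∈ Finset.range N, T k = 1 := by
    rw [← map_sum, hθ, map_one]
  have hshift : ∀ g : ℕ → R, g N = g 0 →
      ∑ k ∈ Finset.range N, g (k + 1) = ∑ k ∈ Finset.range N, g k := by
    intro g hg
    have h1 := Finset.sum_range_succ g N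
    rw [Finset.sum_range_succ', hg] at h1
    exact add_right_cancel h1
  change S (-∑ k ∈ Finset.range N, P k * T k) = -∑ k ∈ Finset.range N, P k * T k + r
  simp only [map_neg, map_sum, map_mul, hP, hT, sub_mul, Finset.sum_sub_distrib,
    ← Finset.mul_sum]
  rw [hshift T hTN, hsum, hshift (fun k => P k * T k) (by simp [hPN, hP0])]
  ring

theorem der_primitive (h : IsRadicalExtension p σ S Y D f) (N : ℕ) (θ : L) (r : R) (i : ι) :
    D i (primitive σ S N θ r) = primitive σ S N θ (D i r) := by
  simp only [primitive, map_neg, map_sum, Derivation.leibniz, Derivation.map_algebraMap,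
    h.pow_map_der, smul_eq_mul, mul_zero, zero_add]
  simp only [mul_comm]

end IsRadicalExtension

end

section

variable {F L R ι : Type*} [Field F] [Field L] [Algebra F L] [CommRing R] [Algebra F R]
  [Algebra L R] [IsScalarTower F L R] {p : ℕ} {σ : Gal(L/F)}
  {S : R →ₐ[F] R} {Y : ι → R} {D : ι → Derivation L R R} {f : ι → F}

theorem sum_range_mul_eq_zero [CharP R p] (S : R →ₐ[F] R) {m : ℕ} {r : R}
    (hr : (S ^ m) r = r) : ∑ k ∈ Finset.range (m * p), (S ^ k) r = 0 := by
  have h : ∀ q : ℕ, ∑ k ∈ Finset.range (m * q), (S ^ k) r =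
      q • ∑ k ∈ Finset.range m, (S ^ k) r := by
    intro q
    induction q with
    | zero => simp
    | succ q ih =>
      have hq : (S ^ (m * q)) r = r := by
        rw [pow_mul]
        clear ih
        induction q with
        | zero => rfl
        | succ q ih => rw [pow_succ, AlgHom.mul_apply, hr, ih]
      rw [Nat.mul_succ, Finset.sum_range_add, ih, succ_nsmul]
      congr 1
      refine Finset.sum_congr rfl fun k _ => ?_
      rw [add_comm, pow_add, AlgHom.mul_apply, hq]
  rw [h, nsmul_eq_mul, CharP.cast_eq_zero, zero_mul]

theorem prod_range_mul_eq_pow (S : R →ₐ[F] R) {m : ℕ} {d : R} (hd : (S ^ m) d = d) (q : ℕ) :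
    ∏ k ∈ Finset.range (m * q), (S ^ k) d = (∏ k ∈ Finset.range m, (S ^ k) d) ^ q := by
  induction q with
  | zero => simp
  | succ q ih =>
    have hq : (S ^ (m * q)) d = d := by
      rw [pow_mul]
      clear ih
      induction q with
      | zero => rfl
      | succ q ih => rw [pow_succ, AlgHom.mul_apply, hd, ih]
    rw [Nat.mul_succ, Finset.prod_range_add, ih, pow_succ]
    congr 1
    refine Finset.prod_congr rfl fun k _ => ?_
    rw [add_comm, pow_add, AlgHom.mul_apply, hq]

namespace IsRadicalExtension

/-- The commutant of the operators attached to a radical extension consists of scalars. -/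
theorem exists_eq_smul_of_commute [FiniteDimensional F L] [IsGalois F L] [Nontrivial R]
    (h : IsRadicalExtension p σ S Y D f)
    (hσ : ∀ x, σ x = x → ∃ a, algebraMap F L a = x) {d : R} (hd : IsUnit d) {w : ι → R}
    (T : Module.End F R) (hTL : ∀ x t, T (algebraMap L R x * t) = algebraMap L R x * T t)
    (hTY : ∀ i t, T (Y i * t) = Y i * T t) (hTu : ∀ t, T (d * S t) = d * S (T t))
    (hTz : ∀ i t, T (D i t + w i * t) = D i (T t) + w i * T t) :
    ∃ a : F, ∀ t, T t = a • t := by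
  have hT : ∀ t, ∀ s, T (t * s) = t * T s := by
    refine h.induction _ hTL ?_ ?_
    · intro s t hs ht x
      rw [add_mul, map_add, hs, ht, add_mul]
    · intro i t ht s
      rw [mul_assoc, hTY, ht, mul_assoc]
  have hT1 : ∀ t, T t = t * T 1 := fun t => by rw [← hT, mul_one]
  have hS : S (T 1) = T 1 := by
    have h1 := hTu 1
    rw [map_one, hT] at h1
    exact (hd.mul_left_cancel h1).symm
  have hD : ∀ i, D i (T 1) = 0 := by
    intro i
    have h1 := hTz i 1
    rw [Derivation.map_one_eq_zero, zero_add, hT] at h1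
    exact right_eq_add.1 h1
  obtain ⟨x, hx⟩ := h.mem_range_of_der _ hD
  obtain ⟨a, rfl⟩ := hσ x ((algebraMap L R).injective (by rw [← h.map_algebraMap, hx, hS]))
  refine ⟨a, fun t => ?_⟩
  rw [hT1, ← hx, ← IsScalarTower.algebraMap_apply, Algebra.smul_def, mul_comm]

/-- The operators on a radical extension generating its endomorphism algebra. -/
theorem exists_operators [Fintype ι] [hp : Fact p.Prime] [CharP R p] [FiniteDimensional F L]
    [IsGalois F L] [FiniteDimensional F R] [Nontrivial R] (h : IsRadicalExtension p σ S Y D f)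
    (hσ : ∀ x, σ x = x → ∃ a, algebraMap F L a = x) {m : ℕ} (hN : σ ^ (m * p) = 1) {θ : L}
    (hθ : ∑ k ∈ Finset.range (m * p), (σ ^ k) θ = 1) {c : L} (hc : c ≠ 0) {b : F}
    (hcb : ∏ k ∈ Finset.range m, (σ ^ k) c = algebraMap F L b) {e : ι → L}
    (he : ∀ i, (σ ^ m) (e i) = e i) (hce : c = ∑ i, algebraMap F L (f i) * e i ^ p) :
    ∃ (u : Module.End F R) (y z : ι → Module.End F R) (a : ι → F),
      (∀ x, u * Algebra.lmul F R (algebraMap L R x) =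
        Algebra.lmul F R (algebraMap L R (σ x)) * u) ∧
      u ^ (m * p) = algebraMap F _ b ∧
      (∀ i x, Commute (Algebra.lmul F R (algebraMap L R x)) (y i)) ∧
      (∀ i x, Commute (Algebra.lmul F R (algebraMap L R x)) (z i)) ∧
      (∀ i, Commute u (y i)) ∧ (∀ i, Commute u (z i)) ∧
      (∀ i j, Commute (y i) (y j)) ∧ (∀ i j, Commute (z i) (z j)) ∧
      (∀ i j, i ≠ j → Commute (y i) (z j)) ∧
      (∀ i, y i * z i = (z i - 1) * y i) ∧ (∀ i, y i ^ p = algebraMap F _ (f i)) ∧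
      (∀ i, z i ^ p - z i = algebraMap F _ (a i)) ∧
      ∀ A : Subalgebra F (Module.End F R), (∀ x, Algebra.lmul F R (algebraMap L R x) ∈ A) →
        u ∈ A → (∀ i, y i ∈ A) → (∀ i, z i ∈ A) → A = ⊤ := by
  classical
  let d : R := ∑ i, algebraMap L R (e i) * Y i
  have hdp : d ^ p = algebraMap L R c := by
    simp only [d, sum_pow_char, mul_pow, h.root_pow, hce, map_sum, map_mul, map_pow,
      ← IsScalarTower.algebraMap_apply]
    exact Finset.sum_congr rfl fun i _ => mul_comm _ _
  have hd : IsUnit d := by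
    rw [← isUnit_pow_iff hp.out.ne_zero, hdp]
    exact hc.isUnit.map _
  have hSY : ∀ i, (S ^ m) (algebraMap L R (e i) * Y i) = algebraMap L R (e i) * Y i := fun i => by
    rw [map_mul, h.pow_map_algebraMap, he, h.pow_map_root]
  have hSd : (S ^ m) d = d := by
    simp only [d, map_sum, hSY]
  choose r hr using fun i => hd.dvd (a := algebraMap L R (e i) * Y i)
  have hSr : ∀ i, (S ^ m) (r i) = r i := fun i => by
    apply hd.mul_left_cancel
    rw [← hr, ← hSY, hr, map_mul, hSd]
  let w : ι → R := fun i => primitive σ S (m * p) θ (r i)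
  have hSw : ∀ i, S (w i) = w i + r i := fun i =>
    h.map_primitive hN hθ (sum_range_mul_eq_zero S (hSr i))
  have hDY : ∀ i j t, D i (Y j * t) = Y j * D i t + if j = i then Y j * t else 0 := by
    intro i j t
    rw [Derivation.leibniz, smul_eq_mul, smul_eq_mul]
    split_ifs with hij
    · subst hij
      rw [h.der_root_self, mul_comm t]
    · rw [h.der_root_of_ne i j hij, mul_zero]
  have hDL : ∀ i x t, D i (algebraMap L R x * t) = algebraMap L R x * D i t := by
    intro i x t
    rw [Derivation.leibniz, Derivation.map_algebraMap, smul_zero, add_zero, smul_eq_mul]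
  have hDeY : ∀ i j, D i (algebraMap L R (e j) * Y j) =
      if j = i then algebraMap L R (e j) * Y j else 0 := by
    intro i j
    have := hDY i j 1
    rw [mul_one, Derivation.map_one_eq_zero, mul_zero, zero_add] at this
    rw [hDL, this, mul_ite, mul_zero]
  have hDd : ∀ i, D i d = algebraMap L R (e i) * Y i := by
    intro i
    simp only [d, map_sum, hDeY]
    simp
  have hDr : ∀ i j, D i (r j) = D j (r i) := by
    intro i j
    have key : ∀ i j, d * D i (r j) =
        (if j = i then algebraMap L R (e j) * Y j else 0) - d * r i * r j := by
      intro i j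
      have h1 := congrArg (D i) (hr j)
      rw [hDeY, Derivation.leibniz, hDd, hr i, smul_eq_mul, smul_eq_mul] at h1
      rw [h1]
      ring
    apply hd.mul_left_cancel
    rw [key, key]
    by_cases hij : j = i
    · subst hij
      rfl
    · simp only [if_neg hij, if_neg (Ne.symm hij)]
      ring
  have hDw : ∀ i j, D i (w j) = D j (w i) := fun i j => by
    simp only [w, h.der_primitive, hDr i j]
  let l : R → Module.End F R := fun t => Algebra.lmul F R t
  have hl : ∀ s t, l s t = s * t := fun s t => rfl
  let u : Module.End F R := l d * S.toLinearMap
  have hu : ∀ t, u t = d * S t := fun t => rfl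
  let D' : ι → Module.End F R := fun i => (D i).toLinearMap.restrictScalars F
  let z : ι → Module.End F R := fun i => D' i + l (w i)
  have hz : ∀ i t, z i t = D i t + w i * t := fun i t => rfl
  let y : ι → Module.End F R := fun i => l (Y i)
  have hy : ∀ i t, y i t = Y i * t := fun i t => rfl
  have hlcomm : ∀ s t, Commute (l s) (l t) := fun s t => (Commute.all s t).map (Algebra.lmul F R)
  have hLz : ∀ i x, Commute (l (algebraMap L R x)) (z i) := by
    intro i x
    ext t
    simp only [Module.End.mul_apply, hl, hz, hDL]
    ring
  have huz : ∀ i, Commute u (z i) := by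
    intro i
    ext t
    simp only [Module.End.mul_apply, hu, hz, map_add, map_mul, hSw, Derivation.leibniz,
      smul_eq_mul, hDd, h.map_der, hr]
    ring
  have hzz : ∀ i j, Commute (z i) (z j) := by
    intro i j
    ext t
    simp only [Module.End.mul_apply, hz, map_add, Derivation.leibniz, smul_eq_mul,
      h.der_comm i j, hDw i j]
    ring
  have hyz : ∀ i j, i ≠ j → Commute (y i) (z j) := by
    intro i j hij
    ext t
    simp only [Module.End.mul_apply, hy, hz, hDY, if_neg hij]
    ring
  have hyz' : ∀ i, y i * z i = (z i - 1) * y i := by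
    intro i
    ext t
    simp only [Module.End.mul_apply, LinearMap.sub_apply, Module.End.one_apply, hy, hz, hDY,
      if_true]
    ring
  have huL : ∀ x, u * l (algebraMap L R x) = l (algebraMap L R (σ x)) * u := by
    intro x
    ext t
    simp only [Module.End.mul_apply, hu, hl, map_mul, h.map_algebraMap]
    ring
  have huy : ∀ i, Commute u (y i) := by
    intro i
    ext t
    simp only [Module.End.mul_apply, hu, hy, map_mul, h.map_root]
    ring
  have hupow : ∀ (k : ℕ) t, (u ^ k) t = (∏ i ∈ Finset.range k, (S ^ i) d) * (S ^ k) t := by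
    intro k t
    induction k with
    | zero => simp
    | succ k ih =>
      rw [pow_succ', Module.End.mul_apply, ih, hu, map_mul, map_prod, Finset.prod_range_succ']
      simp only [pow_succ', AlgHom.mul_apply, pow_zero, AlgHom.one_apply]
      ring
  have huN : u ^ (m * p) = algebraMap F _ b := by
    ext t
    rw [hupow, h.pow_map_eq_one hN, prod_range_mul_eq_pow S hSd, ← Finset.prod_pow]
    simp only [← map_pow, hdp, h.pow_map_algebraMap]
    rw [← map_prod, hcb, ← IsScalarTower.algebraMap_apply, ← Algebra.smul_def]
    rfl
  have hypow : ∀ i, y i ^ p = algebraMap F _ (f i) := by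
    intro i
    change Algebra.lmul F R (Y i) ^ p = _
    rw [← map_pow, h.root_pow, AlgHom.commutes]
  have hcommutant : ∀ T : Module.End F R, (∀ x, Commute T (l (algebraMap L R x))) →
      Commute T u → (∀ i, Commute T (y i)) → (∀ i, Commute T (z i)) →
      ∃ a : F, ∀ t, T t = a • t := by
    intro T hTL hTu hTy hTz
    exact h.exists_eq_smul_of_commute hσ hd (w := w) T
      (fun x t => LinearMap.congr_fun (hTL x).eq t) (fun i t => LinearMap.congr_fun (hTy i).eq t)
      (fun t => LinearMap.congr_fun hTu.eq t) (fun i t => LinearMap.congr_fun (hTz i).eq t)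
  have hscalar : ∀ i, ∃ a : F, z i ^ p - z i = algebraMap F _ a := by
    intro i
    obtain ⟨a, ha⟩ := hcommutant (z i ^ p - z i)
      (fun x => (((hLz i x).symm.pow_left p).sub_left (hLz i x).symm))
      (((huz i).symm.pow_left p).sub_left (huz i).symm)
      (fun j => by
        by_cases hij : j = i
        · subst hij
          have hpow : ∀ k : ℕ, y j * z j ^ k = (z j - 1) ^ k * y j := by
            intro k
            induction k with
            | zero => simp
            | succ k ih => rw [pow_succ, ← mul_assoc, ih, mul_assoc, hyz', ← mul_assoc, pow_succ]
          have hchar : CharP (Module.End F R) p :=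
            charP_of_injective_ringHom (f := (Algebra.lmul F R).toRingHom) (fun s t hst => by
              simpa using LinearMap.congr_fun hst 1) p
          refine Eq.symm ?_
          rw [mul_sub, hpow, hyz', sub_pow_char_of_commute p (Commute.one_right _), one_pow]
          rw [← sub_mul, sub_sub_sub_cancel_right]
        · exact ((hyz j i hij).symm.pow_left p).sub_left (hyz j i hij).symm)
      (fun j => ((hzz i j).pow_left p).sub_left (hzz i j))
    exact ⟨a, LinearMap.ext ha⟩
  choose a ha using hscalar
  refine ⟨u, y, z, a, huL, huN, fun i x => hlcomm _ _, fun i x => hLz i x, huy, huz,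
    fun i j => hlcomm _ _, hzz, hyz, hyz', hypow, ha, fun A hAL hAu hAy hAz => ?_⟩
  refine Subalgebra.eq_top_of_irreducible A (fun U hU => ?_) (fun T hT => ?_)
  · have hUmul : ∀ s, ∀ t ∈ U, s * t ∈ U := by
      refine h.induction _ ?_ ?_ ?_
      · exact fun x t ht => hU _ (hAL x) t ht
      · intro s t hs ht x hx
        rw [add_mul]
        exact add_mem (hs x hx) (ht x hx)
      · intro i t ht x hx
        rw [mul_assoc]
        exact hU _ (hAy i) _ (ht x hx)
    let I : Ideal R := { U with smul_mem' := hUmul }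
    have hI : ∀ t, t ∈ I ↔ t ∈ U := fun t => Iff.rfl
    by_cases hbot : I = ⊥
    · left
      rw [eq_bot_iff]
      intro t ht
      have : t ∈ I := ht
      rwa [hbot] at this
    · right
      have htop := h.eq_top I (fun i t ht => by
        have h1 : z i t ∈ U := hU _ (hAz i) t ht
        have h2 := U.sub_mem h1 (hUmul (w i) t ht)
        rwa [hz, add_sub_cancel_right] at h2) hbot
      rw [eq_top_iff]
      intro t _
      have : t ∈ I := htop ▸ Submodule.mem_top
      exact this
  · exact hcommutant T (fun x => hT _ (hAL x)) (hT _ hAu) (fun i => hT _ (hAy i))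
      (fun i => hT _ (hAz i))

end IsRadicalExtension

end

section

theorem prod_range_orderOf_eq_prod_univ {G M : Type*} [Group G] [Fintype G] [CommMonoid M]
    {σ : G} (hσ : ∀ τ : G, τ ∈ Subgroup.zpowers σ) (g : G → M) :
    ∏ k ∈ Finset.range (orderOf σ), g (σ ^ k) = ∏ τ, g τ := by
  classical
  rw [← IsCyclic.image_range_orderOf hσ, Finset.prod_image]
  intro a ha b hb hab
  exact pow_injOn_Iio_orderOf (by simpa using ha) (by simpa using hb) hab

variable {F L : Type*} [Field F] [Field L] [Algebra F L] [FiniteDimensional F L] [IsGalois F L]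
  {σ : Gal(L/F)}

theorem exists_sum_range_pow_apply_eq_one (hσ : ∀ τ : Gal(L/F), τ ∈ Subgroup.zpowers σ) :
    ∃ θ : L, ∑ k ∈ Finset.range (orderOf σ), (σ ^ k) θ = 1 := by
  obtain ⟨θ, hθ⟩ := Algebra.trace_surjective F L 1
  refine ⟨θ, ?_⟩
  have h := trace_eq_sum_automorphisms (K := F) θ
  rw [hθ, map_one] at h
  rw [h]
  exact prod_range_orderOf_eq_prod_univ (M := Multiplicative L) hσ
    fun τ => Multiplicative.ofAdd (τ θ)

/-- If `L/F` is cyclic with generator `σ`, an element of the subextension of degree `m` fixed by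
`σ ^ m` is an `F`-linear combination with nonzero coefficients of at most `m` many `p`-th powers
of elements of that subextension. -/
theorem exists_eq_sum_mul_pow {p : ℕ} [Fact p.Prime] [CharP F p] {m q : ℕ} (hq : 0 < q)
    (hσ : orderOf σ = m * q) (hσL : orderOf σ = Module.finrank F L) {c : L}
    (hc : (σ ^ m) c = c) :
    ∃ (k : ℕ) (f : Fin k → F) (e : Fin k → L), k ≤ m ∧ (∀ i, f i ≠ 0) ∧
      (∀ i, (σ ^ m) (e i) = e i) ∧ c = ∑ i, algebraMap F L (f i) * e i ^ p := by
  classical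
  let K := IntermediateField.fixedField (Subgroup.zpowers (σ ^ m))
  have hK : ∀ x : L, x ∈ K ↔ (σ ^ m) x = x := by
    intro x
    refine ⟨fun hx => hx ⟨σ ^ m, Subgroup.mem_zpowers _⟩, fun hx τ => ?_⟩
    have h : Subgroup.zpowers (σ ^ m) ≤ MulAction.stabilizer Gal(L/F) x := by
      rw [Subgroup.zpowers_le]
      exact hx
    exact h τ.2
  have hcard : Module.finrank F K = m := by
    have h1 : Module.finrank K L = q := by
      rw [IntermediateField.finrank_fixedField_eq_card, Nat.card_zpowers, orderOf_pow, hσ,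
        Nat.gcd_mul_right_left]
      have hm : 0 < m := by
        rcases Nat.eq_zero_or_pos m with rfl | h
        · rw [zero_mul] at hσ
          have : 0 < Module.finrank F L := Module.finrank_pos
          omega
        · exact h
      exact Nat.mul_div_cancel_left _ hm
    have h2 := Module.finrank_mul_finrank F K L
    rw [h1, ← hσL, hσ] at h2
    exact Nat.eq_of_mul_eq_mul_right hq h2
  have : ExpChar F p := ExpChar.prime Fact.out
  let B := Module.finBasis F K
  have hspan := Field.span_map_pow_expChar_pow_eq_top_of_isSeparable p 1 B.span_eq
  have hcK : (⟨c, (hK c).2 hc⟩ : K) ∈ Submodule.span F (Set.range (B · ^ p ^ 1)) := by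
    rw [hspan]
    trivial
  obtain ⟨g, hg⟩ := (Submodule.mem_span_range_iff_exists_fun F).1 hcK
  let s := Finset.univ.filter fun i => g i ≠ 0
  let ε := s.equivFin
  refine ⟨s.card, fun i => g (ε.symm i), fun i => B (ε.symm i), ?_, fun i => ?_, fun i => ?_, ?_⟩
  · calc s.card ≤ Finset.univ.card := Finset.card_le_univ _
      _ = m := by rw [Finset.card_univ, Fintype.card_fin, hcard]
  · exact (Finset.mem_filter.1 (ε.symm i).2).2
  · exact (hK _).1 (B _).2
  · have h1 := congrArg (algebraMap K L) hg
    rw [map_sum] at h1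
    rw [ε.symm.sum_comp (fun i : s => algebraMap F L (g i) * (B i : L) ^ p),
      Finset.sum_coe_sort s (fun i => algebraMap F L (g i) * (B i : L) ^ p),
      Finset.sum_filter_of_ne]
    · refine Eq.symm (Eq.trans ?_ h1)
      refine Finset.sum_congr rfl fun i _ => ?_
      simp [Algebra.smul_def]
    · intro i _ hi h0
      simp [h0] at hi

end

section

variable {F L A B : Type*} [Field F] [Field L] [Algebra F L] [Ring A] [Algebra F A]
  [Ring B] [Algebra F B]

/-- The linear map sending `x` to `∑ k, x k * u ^ k`. -/
noncomputable def sumMulPow (j : L →ₐ[F] A) (u : A) (N : ℕ) : (Fin N → L) →ₗ[F] A :=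
  ∑ k : Fin N, ((LinearMap.mulRight F (u ^ (k : ℕ))).comp j.toLinearMap).comp (LinearMap.proj k)

theorem sumMulPow_apply (j : L →ₐ[F] A) (u : A) (N : ℕ) (x : Fin N → L) :
    sumMulPow j u N x = ∑ k, j (x k) * u ^ (k : ℕ) := by
  simp [sumMulPow, LinearMap.sum_apply]

theorem sumMulPow_single (j : L →ₐ[F] A) (u : A) {N : ℕ} (k : Fin N) (x : L) :
    sumMulPow j u N (Pi.single k x) = j x * u ^ (k : ℕ) := by
  classical
  rw [sumMulPow_apply, Finset.sum_eq_single k]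
  · rw [Pi.single_eq_same]
  · intro l _ hl
    rw [Pi.single_eq_of_ne hl, map_zero, zero_mul]
  · simp

theorem sumMulPow_bijective [FiniteDimensional F L] [IsGalois F L] [FiniteDimensional F A]
    [Nontrivial A] (j : L →ₐ[F] A) (hA : Module.finrank F A = Module.finrank F L ^ 2)
    {σ : Gal(L/F)} (hσ : orderOf σ = Module.finrank F L) {u : A} (hu1 : IsUnit u)
    (hu : ∀ y, u * j y = j (σ y) * u) :
    Function.Bijective (sumMulPow j u (Module.finrank F L)) := by
  have hj : Function.Injective j := j.toRingHom.injective
  have hinj : Function.Injective (sumMulPow j u (Module.finrank F L)) := by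
    rw [injective_iff_map_eq_zero]
    intro x hx
    ext l
    have htw : ∀ k : Fin (Module.finrank F L), j (x k) * u ^ (k : ℕ) ∈
        twistedCentralizer j (σ ^ (k : ℕ)) := fun k y => by
      rw [mul_assoc, pow_mul_of_mul_eq hu, ← mul_assoc, ← mul_assoc, ← map_mul, ← map_mul,
        mul_comm]
    have h := congrArg (bimoduleAction j (galoisIdem (σ ^ (l : ℕ)))) hx
    rw [sumMulPow_apply, map_sum, map_zero, Finset.sum_eq_single l,
      galoisIdem_apply_self _ _ _ (mem_twistedCentralizer_iff_bimoduleAction.1 (htw l))] at h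
    · rw [(hu1.pow _).mul_left_eq_zero] at h
      exact hj (h.trans (map_zero j).symm)
    · intro k _ hkl
      refine galoisIdem_apply_of_ne _ (fun hpow => hkl ?_) _
        (mem_twistedCentralizer_iff_bimoduleAction.1 (htw k))
      exact Fin.ext (pow_injOn_Iio_orderOf (by simp [hσ]) (by simp [hσ]) hpow)
    · simp
  refine ⟨hinj, (LinearMap.injective_iff_surjective_of_finrank_eq_finrank ?_).1 hinj⟩
  rw [hA, Module.finrank_pi_fintype, Finset.sum_const, Finset.card_univ, Fintype.card_fin,
    smul_eq_mul, sq]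

/-- The universal property of the cyclic algebra generated by `L` and `u`. -/
theorem exists_algHom_apply_eq [FiniteDimensional F L] [IsGalois F L] [FiniteDimensional F A]
    [Nontrivial A] (j : L →ₐ[F] A) (hA : Module.finrank F A = Module.finrank F L ^ 2)
    {σ : Gal(L/F)} (hσ : orderOf σ = Module.finrank F L) {u : A} (hu1 : IsUnit u)
    (hu : ∀ y, u * j y = j (σ y) * u) {b : F}
    (hub : u ^ Module.finrank F L = algebraMap F A b) (j' : L →ₐ[F] B) {u' : B}
    (hu' : ∀ y, u' * j' y = j' (σ y) * u')
    (hub' : u' ^ Module.finrank F L = algebraMap F B b) :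
    ∃ ρ : A →ₐ[F] B, (∀ x, ρ (j x) = j' x) ∧ ρ u = u' ∧
      ∀ s, (∀ x, Commute s (j' x)) → Commute s u' → ∀ a, Commute s (ρ a) := by
  set N := Module.finrank F L with hN
  have hNpos : 0 < N := Module.finrank_pos
  let Φ := LinearEquiv.ofBijective _ (sumMulPow_bijective j hA hσ hu1 hu)
  let ρ : A →ₗ[F] B := (sumMulPow j' u' N).comp Φ.symm.toLinearMap
  have hρΦ : ∀ x, ρ (sumMulPow j u N x) = sumMulPow j' u' N x := fun x => by
    change sumMulPow j' u' N (Φ.symm (Φ x)) = _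
    rw [Φ.symm_apply_apply]
  have hρ : ∀ (x : L) (k : ℕ), ρ (j x * u ^ k) = j' x * u' ^ k := by
    intro x k
    have h1 : ∀ r < N, ρ (j x * u ^ r) = j' x * u' ^ r := fun r hr => by
      have := hρΦ (Pi.single ⟨r, hr⟩ x)
      rwa [sumMulPow_single, sumMulPow_single] at this
    conv_lhs => rw [← Nat.div_add_mod k N, pow_add, pow_mul, hub, ← map_pow, ← Algebra.smul_def,
      mul_smul_comm, map_smul, h1 _ (Nat.mod_lt _ hNpos)]
    conv_rhs => rw [← Nat.div_add_mod k N, pow_add, pow_mul, hub', ← map_pow, ← Algebra.smul_def,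
      mul_smul_comm]
  have hρj : ∀ x, ρ (j x) = j' x := fun x => by simpa using hρ x 0
  have hmul : ∀ a c, ρ (a * c) = ρ a * ρ c := by
    intro a c
    obtain ⟨x, rfl⟩ := Φ.surjective a
    obtain ⟨y, rfl⟩ := Φ.surjective c
    change ρ (sumMulPow j u N x * sumMulPow j u N y) =
      ρ (sumMulPow j u N x) * ρ (sumMulPow j u N y)
    simp only [sumMulPow_apply, Finset.sum_mul_sum, map_sum, hρ]
    refine Finset.sum_congr rfl fun k _ => Finset.sum_congr rfl fun l _ => ?_
    have h1 : j (x k) * u ^ (k : ℕ) * (j (y l) * u ^ (l : ℕ)) =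
        j (x k * (σ ^ (k : ℕ)) (y l)) * u ^ ((k : ℕ) + l) := by
      rw [mul_assoc, ← mul_assoc (u ^ _), pow_mul_of_mul_eq hu, map_mul, pow_add]
      simp only [mul_assoc]
    have h2 : j' (x k) * u' ^ (k : ℕ) * (j' (y l) * u' ^ (l : ℕ)) =
        j' (x k * (σ ^ (k : ℕ)) (y l)) * u' ^ ((k : ℕ) + l) := by
      rw [mul_assoc, ← mul_assoc (u' ^ _), pow_mul_of_mul_eq hu', map_mul, pow_add]
      simp only [mul_assoc]
    rw [h1, h2, hρ]
  refine ⟨AlgHom.ofLinearMap ρ (by simpa using hρj 1) hmul, hρj, by simpa using hρ 1 1,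
    fun s hsj hsu a => ?_⟩
  change Commute s (sumMulPow j' u' N (Φ.symm a))
  rw [sumMulPow_apply]
  exact Commute.sum_right _ _ _ fun k _ => (hsj _).mul_right (hsu.pow_right _)

end

section

theorem List.prod_ofFn_mul_of_commute {M : Type*} [Monoid M] {k : ℕ} (g h : Fin k → M)
    (hgh : ∀ i j, i ≠ j → Commute (g i) (h j)) :
    (List.ofFn fun i => g i * h i).prod = (List.ofFn g).prod * (List.ofFn h).prod := by
  induction k with
  | zero => simp
  | succ k ih =>
    have hcomm : Commute (h 0) (List.ofFn fun i : Fin k => g i.succ).prod := by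
      refine Commute.list_prod_right _ _ fun x hx => ?_
      obtain ⟨i, rfl⟩ := List.mem_ofFn.1 hx
      exact (hgh _ _ (Fin.succ_ne_zero i)).symm
    simp only [List.ofFn_succ, List.prod_cons]
    rw [ih _ _ fun i j hij => hgh _ _ (by simpa using hij), mul_assoc, mul_assoc,
      ← mul_assoc (h 0), hcomm.eq, mul_assoc]

theorem List.prod_ofFn_mulSingle {M : Type*} [Monoid M] {k : ℕ} (i : Fin k) (s : M) :
    (List.ofFn (Pi.mulSingle i s : Fin k → M)).prod = s := by
  induction k with
  | zero => exact i.elim0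
  | succ k ih =>
    rw [List.ofFn_succ, List.prod_cons]
    refine Fin.cases ?_ (fun i => ?_) i
    · rw [Pi.mulSingle_eq_same, List.prod_eq_one, mul_one]
      intro x hx
      obtain ⟨l, rfl⟩ := List.mem_ofFn.1 hx
      exact Pi.mulSingle_eq_of_ne (Fin.succ_ne_zero l) s
    · rw [Pi.mulSingle_eq_of_ne (Fin.succ_ne_zero i).symm, one_mul]
      refine Eq.trans ?_ (ih i)
      congr 2
      ext l
      simp [Pi.mulSingle_apply]

variable {F S : Type*} [Field F] [Ring S] [Algebra F S] {k : ℕ} {A : Fin k → Type*}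
  [∀ i, Ring (A i)] [∀ i, Algebra F (A i)]

/-- Homomorphisms with commuting images induce a homomorphism on the tensor product. -/
noncomputable def PiTensorProduct.liftOfCommute (φ : ∀ i, A i →ₐ[F] S)
    (hφ : ∀ i j, i ≠ j → ∀ x y, Commute (φ i x) (φ j y)) : (⨂[F] i, A i) →ₐ[F] S :=
  PiTensorProduct.liftAlgHom
    ((MultilinearMap.mkPiAlgebraFin F k S).compLinearMap fun i => (φ i).toLinearMap)
    (by simp) fun x y => by
      simpa using List.prod_ofFn_mul_of_commute (fun i => φ i (x i)) (fun i => φ i (y i))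
        fun i j hij => hφ i j hij _ _

theorem PiTensorProduct.liftOfCommute_tprod (φ : ∀ i, A i →ₐ[F] S)
    (hφ : ∀ i j, i ≠ j → ∀ x y, Commute (φ i x) (φ j y)) (x : ∀ i, A i) :
    PiTensorProduct.liftOfCommute φ hφ (PiTensorProduct.tprod F x) =
      (List.ofFn fun i => φ i (x i)).prod := by
  simp [PiTensorProduct.liftOfCommute]

theorem PiTensorProduct.liftOfCommute_single (φ : ∀ i, A i →ₐ[F] S)
    (hφ : ∀ i j, i ≠ j → ∀ x y, Commute (φ i x) (φ j y)) (i : Fin k) (a : A i) :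
    PiTensorProduct.liftOfCommute φ hφ (PiTensorProduct.tprod F (Pi.mulSingle i a)) =
      φ i a := by
  rw [PiTensorProduct.liftOfCommute_tprod, ← List.prod_ofFn_mulSingle i (φ i a)]
  congr 2
  ext l
  by_cases h : l = i
  · subst h
    simp
  · simp [h]

theorem PiTensorProduct.commute_liftOfCommute (φ : ∀ i, A i →ₐ[F] S)
    (hφ : ∀ i j, i ≠ j → ∀ x y, Commute (φ i x) (φ j y)) {s : S}
    (hs : ∀ i x, Commute s (φ i x)) (t : ⨂[F] i, A i) :
    Commute s (PiTensorProduct.liftOfCommute φ hφ t) := by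
  induction t using PiTensorProduct.induction_on with
  | smul_tprod r x =>
    rw [map_smul, PiTensorProduct.liftOfCommute_tprod]
    refine (Commute.list_prod_right _ _ fun y hy => ?_).smul_right r
    obtain ⟨i, rfl⟩ := List.mem_ofFn.1 hy
    exact hs _ _
  | add a b ha hb =>
    rw [map_add]
    exact ha.add_right hb

end

/-- The subalgebra generated by the two generators of a cyclic algebra of degree `p` has
dimension at most `p ^ 2`. -/
theorem finrank_adjoin_pair_le {F S : Type*} [Field F] [Ring S] [Algebra F S] {p : ℕ}
    (hp : 1 < p) {y z : S} {a f : F} (hyz : y * z = (z - 1) * y)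
    (hy : y ^ p = algebraMap F S f) (hz : z ^ p - z = algebraMap F S a) :
    FiniteDimensional F (Algebra.adjoin F {z, y}) ∧
      Module.finrank F (Algebra.adjoin F {z, y}) ≤ p ^ 2 := by
  classical
  let g : Fin p × Fin p → S := fun st => z ^ (st.1 : ℕ) * y ^ (st.2 : ℕ)
  let W := Submodule.span F (Set.range g)
  have hg : ∀ s < p, ∀ t < p, z ^ s * y ^ t ∈ W := fun s hs t ht =>
    Submodule.subset_span ⟨(⟨s, hs⟩, ⟨t, ht⟩), rfl⟩
  have hzp : z ^ p = z + algebraMap F S a := by rw [← hz, add_sub_cancel]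
  have hzW : ∀ w ∈ W, z * w ∈ W := by
    intro w hw
    induction hw using Submodule.span_induction with
    | zero => simp
    | add x y _ _ hx hy => rw [mul_add]; exact add_mem hx hy
    | smul c x _ hx => rw [mul_smul_comm]; exact W.smul_mem c hx
    | mem x hx =>
      obtain ⟨⟨s, t⟩, rfl⟩ := hx
      change z * (z ^ (s : ℕ) * y ^ (t : ℕ)) ∈ W
      rw [← mul_assoc, ← pow_succ']
      by_cases hs : (s : ℕ) + 1 < p
      · exact hg _ hs _ t.2
      · have : (s : ℕ) + 1 = p := by omega
        rw [this, hzp, add_mul, ← Algebra.smul_def]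
        refine add_mem ?_ (W.smul_mem a ?_)
        · simpa using hg 1 hp t t.2
        · simpa using hg 0 (by omega) t t.2
  have hyz' : ∀ s : ℕ, y * z ^ s = (z - 1) ^ s * y := by
    intro s
    induction s with
    | zero => simp
    | succ s ih => rw [pow_succ, ← mul_assoc, ih, mul_assoc, hyz, ← mul_assoc, pow_succ]
  have hz1W : ∀ s : ℕ, ∀ w ∈ W, (z - 1) ^ s * w ∈ W := by
    intro s
    induction s with
    | zero => simp
    | succ s ih =>
      intro w hw
      rw [pow_succ, mul_assoc, sub_mul, one_mul]
      exact ih _ (sub_mem (hzW w hw) hw)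
  have hyW : ∀ w ∈ W, y * w ∈ W := by
    intro w hw
    induction hw using Submodule.span_induction with
    | zero => simp
    | add x y _ _ hx hy => rw [mul_add]; exact add_mem hx hy
    | smul c x _ hx => rw [mul_smul_comm]; exact W.smul_mem c hx
    | mem x hx =>
      obtain ⟨⟨s, t⟩, rfl⟩ := hx
      change y * (z ^ (s : ℕ) * y ^ (t : ℕ)) ∈ W
      rw [← mul_assoc, hyz', mul_assoc, ← pow_succ']
      refine hz1W _ _ ?_
      by_cases ht : (t : ℕ) + 1 < p
      · simpa using hg 0 (by omega) _ ht
      · have : (t : ℕ) + 1 = p := by omega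
        rw [this, hy, Algebra.algebraMap_eq_smul_one]
        refine W.smul_mem f ?_
        simpa using hg 0 (by omega) 0 (by omega)
  have hle : Subalgebra.toSubmodule (Algebra.adjoin F {z, y}) ≤ W := by
    intro x hx
    have hmul : ∀ w ∈ W, x * w ∈ W := by
      induction hx using Algebra.adjoin_induction with
      | mem x hx =>
        rcases hx with rfl | rfl
        · exact hzW
        · exact hyW
      | algebraMap c =>
        intro w hw
        rw [← Algebra.smul_def]
        exact W.smul_mem c hw
      | add a b _ _ ha hb =>
        intro w hw
        rw [add_mul]
        exact add_mem (ha w hw) (hb w hw)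
      | mul a b _ _ ha hb =>
        intro w hw
        rw [mul_assoc]
        exact ha _ (hb w hw)
    have h1 : (1 : S) ∈ W := by simpa using hg 0 (by omega) 0 (by omega)
    simpa using hmul 1 h1
  have hW : FiniteDimensional F W := FiniteDimensional.span_of_finite F (Set.finite_range g)
  refine ⟨Submodule.finiteDimensional_of_le hle, ?_⟩
  calc Module.finrank F (Algebra.adjoin F {z, y}) ≤ Module.finrank F W :=
        Submodule.finrank_mono hle
    _ ≤ Fintype.card (Fin p × Fin p) := finrank_range_le_card g
    _ = p ^ 2 := by rw [Fintype.card_prod, Fintype.card_fin, sq]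

/-- A family of commuting subalgebras generating an algebra of large enough dimension makes it a
tensor product. -/
theorem nonempty_tensorProduct_algEquiv {F A E : Type*} [Field F] [Ring A] [Algebra F A]
    [FiniteDimensional F A] [Ring E] [Algebra F E] [FiniteDimensional F E] [Nontrivial A]
    {k d : ℕ} (hd : 0 < d)
    {S : Fin k → Type*} [∀ i, Ring (S i)] [∀ i, Algebra F (S i)] [∀ i, FiniteDimensional F (S i)]
    (ρ : A →ₐ[F] E) (φ : ∀ i, S i →ₐ[F] E)
    (hφ : ∀ i j, i ≠ j → ∀ x y, Commute (φ i x) (φ j y))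
    (hρφ : ∀ a i x, Commute (ρ a) (φ i x)) (hS : ∀ i, Module.finrank F (S i) ≤ d)
    (hE : Module.finrank F A * d ^ k ≤ Module.finrank F E)
    (hgen : ∀ B : Subalgebra F E, (∀ a, ρ a ∈ B) → (∀ i x, φ i x ∈ B) → B = ⊤) :
    (∀ i, Module.finrank F (S i) = d) ∧ Nonempty (A ⊗[F] (⨂[F] i, S i) ≃ₐ[F] E) := by
  classical
  let Φ : A ⊗[F] (⨂[F] i, S i) →ₐ[F] E :=
    Algebra.TensorProduct.lift ρ (PiTensorProduct.liftOfCommute φ hφ) fun a t =>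
      PiTensorProduct.commute_liftOfCommute φ hφ (fun i x => hρφ a i x) t
  have hsurj : Function.Surjective Φ := by
    rw [← AlgHom.range_eq_top]
    refine hgen _ (fun a => ⟨a ⊗ₜ 1, by simp [Φ]⟩) fun i x =>
      ⟨1 ⊗ₜ PiTensorProduct.tprod F (Pi.mulSingle i x), ?_⟩
    have h := PiTensorProduct.liftOfCommute_single φ hφ i x
    simpa [Φ] using h
  have hdim : Module.finrank F (A ⊗[F] (⨂[F] i, S i)) =
      Module.finrank F A * ∏ i, Module.finrank F (S i) := by
    rw [Module.finrank_tensorProduct, finrank_piTensorProduct]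
  have hge : Module.finrank F E ≤ Module.finrank F A * ∏ i, Module.finrank F (S i) := by
    rw [← hdim]
    exact LinearMap.finrank_le_finrank_of_surjective (f := Φ.toLinearMap) hsurj
  have hprod : ∏ i, Module.finrank F (S i) ≤ d ^ k := by
    calc ∏ i, Module.finrank F (S i) ≤ ∏ _i : Fin k, d :=
          Finset.prod_le_prod' fun i _ => hS i
      _ = d ^ k := by simp
  have hApos : 0 < Module.finrank F A := Module.finrank_pos
  have hprod' : d ^ k ≤ ∏ i, Module.finrank F (S i) :=
    Nat.le_of_mul_le_mul_left (hE.trans hge) hApos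
  have heq : ∏ i, Module.finrank F (S i) = d ^ k := le_antisymm hprod hprod'
  refine ⟨fun i => ?_, ⟨AlgEquiv.ofBijective Φ ⟨?_, hsurj⟩⟩⟩
  · have hpos : ∀ i ∈ (Finset.univ : Finset (Fin k)), 0 < Module.finrank F (S i) := by
      intro i hi
      refine Nat.pos_of_ne_zero fun h0 => ?_
      rw [Finset.prod_eq_zero hi h0] at heq
      exact (pow_pos hd k).ne heq
    by_contra hne
    have hlt := Finset.prod_lt_prod hpos (fun i _ => hS i)
      ⟨i, Finset.mem_univ i, lt_of_le_of_ne (hS i) hne⟩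
    rw [heq] at hlt
    simp at hlt
  · refine (LinearMap.injective_iff_surjective_of_finrank_eq_finrank
      (f := Φ.toLinearMap) ?_).2 hsurj
    refine le_antisymm ?_ ?_
    · rw [hdim, heq]
      exact hE
    · rw [hdim]
      exact hge

/-- If `Cᵐᵒᵖ ⊗ T` is split, then `C` and `T` are Brauer equivalent. -/
theorem isBrauerEquiv_of_tensorProduct_algEquiv {F C T V : Type} [Field F] [Ring C] [Algebra F C]
    [Algebra.IsCentral F C] [IsSimpleRing C] [FiniteDimensional F C] [Ring T] [Algebra F T]
    [AddCommGroup V] [Module F V] [FiniteDimensional F V] [Nontrivial V]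
    (ε : Cᵐᵒᵖ ⊗[F] T ≃ₐ[F] Module.End F V) : IsBrauerEquiv F C T := by
  refine ⟨Module.finrank F V, Module.finrank F C, Module.finrank_pos, Module.finrank_pos, ⟨?_⟩⟩
  let ε₁ : C ⊗[F] Cᵐᵒᵖ ≃ₐ[F] Matrix (Fin (Module.finrank F C)) (Fin (Module.finrank F C)) F :=
    (AlgEquiv.ofBijective _ mulLeftRight_bijective).trans (algEquivMatrix (Module.finBasis F C))
  let ε₂ : Cᵐᵒᵖ ⊗[F] T ≃ₐ[F] Matrix (Fin (Module.finrank F V)) (Fin (Module.finrank F V)) F :=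
    ε.trans (algEquivMatrix (Module.finBasis F V))
  exact (matrixEquivTensor _ F C).trans <|
    (Algebra.TensorProduct.congr AlgEquiv.refl ε₂.symm).trans <|
    (Algebra.TensorProduct.assoc F F F C Cᵐᵒᵖ T).symm.trans <|
    (Algebra.TensorProduct.congr ε₁ AlgEquiv.refl).trans <|
    (Algebra.TensorProduct.comm F _ T).trans (matrixEquivTensor _ F T).symm

section

variable {F L C : Type} [Field F] [Field L] [Algebra F L] [FiniteDimensional F L] [IsGalois F L]
  [Ring C] [Algebra F C] [Algebra.IsCentral F C] [IsSimpleRing C] [FiniteDimensional F C]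

/-- If the `p`-fold tensor power of the cyclic algebra `(L, σ, b)` is split, then `b` is the norm of
an element of the subextension of `L` fixed by `σ ^ m`, where `[L : F] = m * p`. -/
theorem exists_fixed_prod_eq_of_isSplitAlg {p m : ℕ} (hp : 0 < p)
    (hsplit : IsSplitAlg F (⨂[F] _ : Fin p, C)) (j : L →ₐ[F] C)
    (hC : Module.finrank F C = Module.finrank F L ^ 2) (hm : Module.finrank F L = m * p)
    {σ : Gal(L/F)} (hσ : ∀ τ : Gal(L/F), τ ∈ Subgroup.zpowers σ) {u : Cˣ} {b : F} (hb : b ≠ 0)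
    (hu : ∀ y, (u : C) * j y = j (σ⁻¹ y) * u)
    (hub : (u : C) ^ Module.finrank F L = algebraMap F C b) :
    ∃ c : L, (σ ^ m) c = c ∧ ∏ k ∈ Finset.range m, (σ ^ k) c = algebraMap F L b := by
  have hord := orderOf_eq_finrank hσ
  have hσ' : ∀ τ : Gal(L/F), τ ∈ Subgroup.zpowers σ⁻¹ := fun τ => by
    rw [Subgroup.zpowers_inv]
    exact hσ τ
  have hord' := orderOf_eq_finrank hσ'
  have hNpos : 0 < Module.finrank F L := Module.finrank_pos
  have hmpos : 0 < m := Nat.pos_of_ne_zero (by rintro rfl; omega)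
  obtain ⟨q, rfl⟩ : ∃ q, p = q + 1 := ⟨p - 1, by omega⟩
  obtain ⟨r, -, ⟨ε⟩⟩ := hsplit
  have hr : r = Module.finrank F L ^ (q + 1) := by
    have h := ε.toLinearEquiv.finrank_eq
    rw [finrank_piTensorProduct, Finset.prod_const, Finset.card_univ, Fintype.card_fin, hC,
      Module.finrank_matrix, Fintype.card_fin, Module.finrank_self, mul_one, ← sq, ← pow_mul,
      mul_comm, pow_mul] at h
    exact (Nat.pow_left_injective two_ne_zero h).symm
  obtain ⟨x, hx⟩ := exists_prod_eq_pow j hC hu hub (V := Fin r → F) q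
    (by rw [Module.finrank_fin_fun, hr])
    ((Matrix.toLinAlgEquiv' : Matrix (Fin r) (Fin r) F ≃ₐ[F] _).toAlgHom.comp ε.toAlgHom)
  refine exists_fixed_prod_eq (x := x) hmpos hp (hord.trans hm) hb ?_
  rw [← hx, ← hm, ← hord', prod_range_orderOf_eq_prod_univ hσ' fun τ => τ x, hord', ← hord,
    prod_range_orderOf_eq_prod_univ hσ fun τ => τ x]

/-- A cyclic algebra `C` for which `Cᵐᵒᵖ` acts on `V`, together with `k` commuting pairs of
operators generating cyclic algebras of degree `p`, in such a way that the operators generate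
`Module.End F V`, is Brauer equivalent to the product of these algebras. -/
theorem symbolLengthLE_of_operators {p k : ℕ} (hp : p.Prime) (j : L →ₐ[F] C)
    (hC : Module.finrank F C = Module.finrank F L ^ 2) {σ : Gal(L/F)}
    (hord : orderOf σ = Module.finrank F L) {u : Cˣ} {b : F}
    (hu : ∀ y, (u : C) * j y = j (σ⁻¹ y) * u)
    (hub : (u : C) ^ Module.finrank F L = algebraMap F C b)
    {V : Type} [AddCommGroup V] [Module F V] [FiniteDimensional F V] [Nontrivial V]
    (hV : Module.finrank F L * p ^ k ≤ Module.finrank F V)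
    (j' : L →ₐ[F] Module.End F V) {v : Module.End F V} {y z : Fin k → Module.End F V}
    {a f : Fin k → F} (hf : ∀ i, f i ≠ 0) (hvL : ∀ x, v * j' x = j' (σ x) * v)
    (hvN : v ^ Module.finrank F L = algebraMap F _ b)
    (hLy : ∀ i x, Commute (j' x) (y i)) (hLz : ∀ i x, Commute (j' x) (z i))
    (hvy : ∀ i, Commute v (y i)) (hvz : ∀ i, Commute v (z i))
    (hyy : ∀ i l, Commute (y i) (y l)) (hzz : ∀ i l, Commute (z i) (z l))
    (hyz : ∀ i l, i ≠ l → Commute (y i) (z l)) (hyz' : ∀ i, y i * z i = (z i - 1) * y i)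
    (hyp : ∀ i, y i ^ p = algebraMap F _ (f i))
    (hzp : ∀ i, z i ^ p - z i = algebraMap F _ (a i))
    (htop : ∀ A : Subalgebra F (Module.End F V), (∀ x, j' x ∈ A) → v ∈ A → (∀ i, y i ∈ A) →
      (∀ i, z i ∈ A) → A = ⊤) :
    SymbolLengthLE p F C k := by
  obtain ⟨ρ, hρj, hρu, hρcomm⟩ := exists_algHom_apply_eq (A := Cᵐᵒᵖ)
    (j.toOpposite fun x y => (Commute.all x y).map j)
    ((MulOpposite.opLinearEquiv F (M := C)).symm.finrank_eq.trans hC) hord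
    (u := MulOpposite.op (u : C)) u.isUnit.op
    (fun x => by
      have h := hu (σ x)
      rw [← AlgEquiv.mul_apply, inv_mul_cancel, AlgEquiv.one_apply] at h
      exact congrArg MulOpposite.op h.symm)
    (b := b) (by rw [← MulOpposite.op_pow, hub]; rfl)
    j' (u' := v) hvL hvN
  let S : Fin k → Subalgebra F (Module.End F V) := fun i => Algebra.adjoin F {z i, y i}
  have hz : ∀ i, z i ∈ S i := fun i => Algebra.subset_adjoin (by simp)
  have hy : ∀ i, y i ∈ S i := fun i => Algebra.subset_adjoin (by simp)
  have hcomm : ∀ s i, Commute s (z i) → Commute s (y i) → ∀ x ∈ S i, Commute s x :=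
    fun s i h1 h2 x hx => Algebra.commute_of_mem_adjoin_of_forall_mem_commute hx (by
      rintro _ (rfl | rfl)
      · exact h1
      · exact h2)
  have hSfin : ∀ i, FiniteDimensional F (S i) := fun i =>
    (finrank_adjoin_pair_le hp.one_lt (hyz' i) (hyp i) (hzp i)).1
  have hSle : ∀ i, Module.finrank F (S i) ≤ p ^ 2 := fun i =>
    (finrank_adjoin_pair_le hp.one_lt (hyz' i) (hyp i) (hzp i)).2
  obtain ⟨hS, ⟨ε⟩⟩ := nonempty_tensorProduct_algEquiv (d := p ^ 2) (pow_pos hp.pos 2) ρ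
    (fun i => (S i).val)
    (fun i l hil s t => by
      refine hcomm _ l ?_ ?_ _ t.2
      · exact (hcomm _ i (hzz _ _) (hyz _ _ hil).symm _ s.2).symm
      · exact (hcomm _ i (hyz _ _ hil.symm) (hyy _ _) _ s.2).symm)
    (fun s i t => hcomm _ i
      (hρcomm _ (fun x => (hLz i x).symm) (hvz i).symm s).symm
      (hρcomm _ (fun x => (hLy i x).symm) (hvy i).symm s).symm _ t.2)
    hSle
    (by
      rw [(MulOpposite.opLinearEquiv F (M := C)).symm.finrank_eq, hC, Module.finrank_linearMap,
        ← pow_mul, mul_comm 2 k, pow_mul, ← mul_pow, ← sq]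
      gcongr)
    (fun B hBρ hBS => htop B (fun x => by rw [← hρj]; exact hBρ _)
      (by rw [← hρu]; exact hBρ _) (fun i => hBS i ⟨_, hy i⟩) fun i => hBS i ⟨_, hz i⟩)
  refine ⟨k, le_rfl, fun i => S i, inferInstance, inferInstance, fun i => ⟨a i, f i, hf i, hS i,
    ⟨z i, hz i⟩, ⟨y i, hy i⟩, Subtype.ext (hzp i), Subtype.ext (hyp i), Subtype.ext (hyz' i), ?_⟩,
    isBrauerEquiv_of_tensorProduct_algEquiv ε⟩
  have h := Algebra.adjoin_adjoin_coe_preimage (R := F) (s := {z i, y i})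
  rw [← h]
  congr 1
  ext t
  simp [Subtype.ext_iff]

/-- The cyclic algebra `(L, σ⁻¹, b)` with `b` a norm from the subextension fixed by `σ ^ m` is
Brauer equivalent to a product of at most `m` cyclic algebras of degree `p`. -/
theorem symbolLengthLE_of_prod_eq {p m : ℕ} [hp : Fact p.Prime] [CharP F p] (j : L →ₐ[F] C)
    (hC : Module.finrank F C = Module.finrank F L ^ 2) (hm : Module.finrank F L = m * p)
    {σ : Gal(L/F)} (hσ : ∀ τ : Gal(L/F), τ ∈ Subgroup.zpowers σ) {u : Cˣ} {b : F} (hb : b ≠ 0)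
    (hu : ∀ y, (u : C) * j y = j (σ⁻¹ y) * u)
    (hub : (u : C) ^ Module.finrank F L = algebraMap F C b) {c : L} (hc : (σ ^ m) c = c)
    (hcb : ∏ k ∈ Finset.range m, (σ ^ k) c = algebraMap F L b) :
    SymbolLengthLE p F C m := by
  have hord := orderOf_eq_finrank hσ
  have hNpos : 0 < Module.finrank F L := Module.finrank_pos
  have hmpos : 0 < m := Nat.pos_of_ne_zero (by rintro rfl; omega)
  have hc0 : c ≠ 0 := by
    rintro rfl
    rw [Finset.prod_eq_zero (Finset.mem_range.2 hmpos) (map_zero (σ ^ 0))] at hcb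
    exact hb ((map_eq_zero _).1 hcb.symm)
  obtain ⟨θ, hθ⟩ := exists_sum_range_pow_apply_eq_one hσ
  obtain ⟨k, f, e, hkm, hf, he, hce⟩ :=
    exists_eq_sum_mul_pow (p := p) hp.out.pos (hord.trans hm) hord hc
  have hcharL : CharP L p := charP_of_injective_algebraMap (algebraMap F L).injective p
  let R := RadicalRing p fun i => algebraMap F L (f i)
  have : NeZero p := ⟨hp.out.ne_zero⟩
  have hRdim : p ^ k ≤ Module.finrank L R := by
    simpa using RadicalRing.pow_card_le_finrank (p := p) (f := fun i => algebraMap F L (f i))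
      fun i => by simpa using hf i
  have hRnt : Nontrivial R :=
    Module.nontrivial_of_finrank_pos ((pow_pos hp.out.pos k).trans_le hRdim)
  have hcharR : CharP R p := charP_of_injective_algebraMap (algebraMap L R).injective p
  have hRfin : FiniteDimensional F R := Module.Finite.trans L R
  obtain ⟨v, y, z, a, hvL, hvN, hLy, hLz, hvy, hvz, hyy, hzz, hyz, hyz', hyp, hzp, htop⟩ :=
    (RadicalRing.isRadicalExtension σ f hf).exists_operators
      (fun x hx => mem_range_algebraMap_of_forall_zpowers hσ hx)
      (by rw [← hm, ← hord, pow_orderOf_eq_one]) (by rw [← hm, ← hord]; exact hθ) hc0 hcb he hce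
  obtain ⟨l, hl, D, _, _, hD, hCD⟩ := symbolLengthLE_of_operators hp.out j hC hord hu hub
    (by rw [← Module.finrank_mul_finrank F L R]; gcongr)
    ((Algebra.lmul F R).comp (IsScalarTower.toAlgHom F L R)) hf hvL (by rw [hm, hvN]) hLy hLz
    hvy hvz hyy hzz hyz hyz' hyp hzp htop
  exact ⟨l, hl.trans hkm, D, _, _, hD, hCD⟩

end

/-- A cyclic algebra of exponent `p` and degree `p ^ n` over a field of
characteristic `p` has `p`-symbol length at most `p ^ (n - 1)`. -/
theorem statement5 (p : ℕ) (hp : p.Prime) (F : Type) [Field F] [CharP F p]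
    (n : ℕ) (hn : 0 < n)
    (C : Type) [Ring C] [Algebra F C] (hC : IsCyclicAlgebra F C (p ^ n))
    (hexp : HasExponent F C p) :
    SymbolLengthLE p F C (p ^ (n - 1)) := by
  obtain ⟨⟨hcentral, hsimple, hfin⟩, hdim, L, _, _, hgal, hcyc, hL, ⟨j⟩⟩ := hC
  have : Fact p.Prime := ⟨hp⟩
  have : FiniteDimensional F L :=
    Module.finite_of_finrank_pos (by rw [hL]; exact pow_pos hp.pos n)
  obtain ⟨σ, hσ⟩ := hcyc.exists_generator
  have hdim' : Module.finrank F C = Module.finrank F L ^ 2 := by rw [hdim, hL]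
  have hm : Module.finrank F L = p ^ (n - 1) * p := by
    rw [hL, ← pow_succ, Nat.sub_add_cancel hn]
  obtain ⟨u, b, hb, hu, hub⟩ := exists_unit_pow_eq_algebraMap j hdim' (σ := σ⁻¹) fun τ => by
    rw [Subgroup.zpowers_inv]
    exact hσ τ
  obtain ⟨c, hc, hcb⟩ :=
    exists_fixed_prod_eq_of_isSplitAlg hp.pos hexp.2.1 j hdim' hm hσ hb hu hub
  exact symbolLengthLE_of_prod_eq j hdim' hm hσ hb hu hub hc hcb
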